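/- If a smooth plane curve $V \subset \mathbb{P}^2$ of degree $d$ meets the arrangement $\mathcal{H} = \{p_0 p_1 p_2(p_0+p_1+p_2)=0\}$ transversally in $4d$ distinct points, then its ML degree equals $d(d+1)$. -/

import Mathlib

open MvPolynomial

namespace MLDeg

lemma hc_mul {f : MvPolynomial (Fin 3) ℂ} {m : ℕ} (hf : f.IsHomogeneous m)
    (a : MvPolynomial (Fin 3) ℂ) (n : ℕ) :
    homogeneousComponent (n + m) (a * f) = homogeneousComponent n a * f := by
  conv_lhs => rw [← sum_homogeneousComponent a, Finset.sum_mul, map_sum]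
  have : ∀ i ∈ Finset.range (a.totalDegree + 1),
      homogeneousComponent (n + m) (homogeneousComponent i a * f) =
        if i = n then homogeneousComponent n a * f else 0 := by
    intro i _
    have h1 : (homogeneousComponent i a * f) ∈ homogeneousSubmodule (Fin 3) ℂ (i + m) :=
      (homogeneousComponent_isHomogeneous i a).mul hf
    rw [homogeneousComponent_of_mem h1]
    by_cases h : i = n
    · subst h; simp
    · rw [if_neg (by omega), if_neg h]
  rw [Finset.sum_congr rfl this, Finset.sum_ite_eq']
  split_ifs with h
  · rfl
  · rw [homogeneousComponent_eq_zero, zero_mul]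
    simpa using h

lemma finrank_hom (n : ℕ) :
    Module.finrank ℂ (homogeneousSubmodule (Fin 3) ℂ n) = (n + 2).choose 2 := by
  rw [homogeneousSubmodule_eq_finsupp_supported]
  have e := Module.finrank_eq_nat_card_basis
    (basisRestrictSupport ℂ {d : Fin 3 →₀ ℕ | d.degree = n})
  refine e.trans ?_
  have : {d : Fin 3 →₀ ℕ | d.degree = n} = ((Finset.univ : Finset (Fin 3)).finsuppAntidiag n : Set _) := by
    ext d
    simp [Finsupp.degree_eq_sum]
  rw [Nat.card_coe_set_eq, this, Set.ncard_coe_finset, Finset.card_finsuppAntidiag_nat_eq_choose]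
  simp only [Finset.card_univ, Fintype.card_fin]
  rw [show 3 + n - 1 = n + 2 by omega, Nat.choose_symm_add]

instance (n : ℕ) : FiniteDimensional ℂ (homogeneousSubmodule (Fin 3) ℂ n) :=
  Module.Finite.iff_fg.2 (homogeneousSubmodule_fg _ _ n)

/-- a nonunit in at least two variables has a nonzero zero -/
lemma exists_zero {n : ℕ} (p : MvPolynomial (Fin (n + 2)) ℂ) (hp : ¬ IsUnit p) :
    ∃ v : Fin (n + 2) → ℂ, v ≠ 0 ∧ eval v p = 0 := by
  by_contra hcon
  push Not at hcon
  have key : ∀ i : Fin (n + 2), (X i : MvPolynomial (Fin (n + 2)) ℂ) ∈ (Ideal.span {p}).radical := by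
    intro i
    rw [← vanishingIdeal_zeroLocus_eq_radical (K := ℂ), mem_vanishingIdeal_iff]
    intro x hx
    have h0 : eval x p = 0 := by
      simpa [aeval_eq_eval] using (mem_zeroLocus_iff.1 hx) p (Ideal.mem_span_singleton_self p)
    by_cases hx0 : x = 0
    · simp [hx0]
    · exact absurd h0 (hcon x hx0)
  obtain ⟨a, ha⟩ := key 0
  obtain ⟨b, hb⟩ := key 1
  rw [Ideal.mem_span_singleton] at ha hb
  have hX : IsRelPrime (X 0 : MvPolynomial (Fin (n + 2)) ℂ) (X 1) := by
    rw [Irreducible.isRelPrime_iff_not_dvd (X_prime (i := 0)).irreducible]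
    rw [X_dvd_X]
    simp
  exact hp ((hX.pow (m := a) (n := b)) ha hb)

/-- the linear form -/
noncomputable def ell : MvPolynomial (Fin 3) ℂ := X 0 + X 1 + X 2

lemma ell_hom : ell.IsHomogeneous 1 :=
  ((isHomogeneous_X _ _).add (isHomogeneous_X _ _)).add (isHomogeneous_X _ _)

lemma eval_ell (v : Fin 3 → ℂ) : eval v ell = v 0 + v 1 + v 2 := by simp [ell]

/-- restriction to the line `ell = 0` -/
noncomputable def resEll : MvPolynomial (Fin 3) ℂ →ₐ[ℂ] MvPolynomial (Fin 2) ℂ :=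
  aeval ![X 0, X 1, - X 0 - X 1]

noncomputable def secEll : MvPolynomial (Fin 2) ℂ →ₐ[ℂ] MvPolynomial (Fin 3) ℂ :=
  aeval ![X 0, X 1]

lemma eval_resEll (w : Fin 2 → ℂ) (q : MvPolynomial (Fin 3) ℂ) :
    eval w (resEll q) = eval ![w 0, w 1, - w 0 - w 1] q := by
  induction q using MvPolynomial.induction_on with
  | C a => simp [resEll]
  | add p q hp hq => simp [hp, hq]
  | mul_X p i hp =>
    simp only [map_mul, hp]
    congr 1
    fin_cases i <;> simp [resEll]

lemma res_sec (q : MvPolynomial (Fin 2) ℂ) : resEll (secEll q) = q := by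
  induction q using MvPolynomial.induction_on with
  | C a => simp [resEll, secEll]
  | add p q hp hq => simp [hp, hq]
  | mul_X p i hp =>
    have hX : resEll (secEll (X i)) = X i := by
      fin_cases i <;> simp [resEll, secEll]
    rw [map_mul, map_mul, hp, hX]

lemma sec_res (q : MvPolynomial (Fin 3) ℂ) : ell ∣ q - secEll (resEll q) := by
  induction q using MvPolynomial.induction_on with
  | C a => simp [resEll, secEll]
  | add p q hp hq =>
    rw [map_add, map_add, add_sub_add_comm]; exact dvd_add hp hq
  | mul_X p i hp =>
    have hX : ell ∣ X i - secEll (resEll (X i)) := by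
      fin_cases i
      · simp [resEll, secEll]
      · simp [resEll, secEll]
      · simp only [resEll, secEll, ell]
        refine ⟨1, ?_⟩
        simp; ring
    rw [map_mul, map_mul]
    have : p * X i - secEll (resEll p) * secEll (resEll (X i)) =
      (p - secEll (resEll p)) * X i + secEll (resEll p) * (X i - secEll (resEll (X i))) := by ring
    rw [this]
    exact dvd_add (hp.mul_right _) (hX.mul_left _)

lemma res_ell : resEll ell = 0 := by simp [resEll, ell]

lemma ell_ne : ell ≠ 0 := by
  intro h
  have := eval_ell ![1, 0, 0]
  simp [h] at this

/-- `ell` is a nonzerodivisor modulo `(f,g)` -/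
lemma ell_cancel {f g h : MvPolynomial (Fin 3) ℂ}
    (hfg : ∀ v : Fin 3 → ℂ, v ≠ 0 → eval v f = 0 → eval v g = 0 → v 0 + v 1 + v 2 ≠ 0)
    (hh : ell * h ∈ Ideal.span {f, g}) : h ∈ Ideal.span {f, g} := by
  have hrel : IsRelPrime (resEll f) (resEll g) := by
    intro p hpf hpg
    by_contra hp
    obtain ⟨w, hw, hpw⟩ := exists_zero (n := 0) p hp
    have h1 : eval w (resEll f) = 0 := by
      obtain ⟨q, hq⟩ := hpf; rw [hq, map_mul, hpw, zero_mul]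
    have h2 : eval w (resEll g) = 0 := by
      obtain ⟨q, hq⟩ := hpg; rw [hq, map_mul, hpw, zero_mul]
    rw [eval_resEll] at h1 h2
    refine hfg _ ?_ h1 h2 (by simp)
    intro h0
    apply hw
    have e0 := congrFun h0 0
    have e1 := congrFun h0 1
    ext i; fin_cases i
    · simpa using e0
    · simpa using e1
  rw [Ideal.mem_span_pair] at hh ⊢
  obtain ⟨a, b, hab⟩ := hh
  have h1 : resEll a * resEll f + resEll b * resEll g = 0 := by
    rw [← map_mul, ← map_mul, ← map_add, hab, map_mul, res_ell, zero_mul]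
  obtain ⟨c, hc, h3⟩ : ∃ c, resEll a = resEll g * c ∧ resEll b = - c * resEll f := by
    by_cases hg0 : resEll g = 0
    · have hu : IsUnit (resEll f) := hrel dvd_rfl (by rw [hg0]; exact dvd_zero _)
      obtain ⟨t, ht⟩ := hu.exists_left_inv
      rw [hg0] at h1 ⊢
      refine ⟨- resEll b * t, ?_, ?_⟩
      · linear_combination t * h1 - resEll a * ht
      · linear_combination - resEll b * ht
    · have h2 : resEll g ∣ resEll a := by
        apply IsRelPrime.dvd_of_dvd_mul_right hrel.symm
        exact ⟨- resEll b, by linear_combination h1⟩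
      obtain ⟨c, hc⟩ := h2
      refine ⟨c, hc, ?_⟩
      apply mul_right_cancel₀ hg0
      rw [hc] at h1
      linear_combination h1
  obtain ⟨a', ha'⟩ := sec_res (a - secEll c * g)
  obtain ⟨b', hb'⟩ := sec_res (b + secEll c * f)
  have ea : resEll (a - secEll c * g) = 0 := by rw [map_sub, map_mul, res_sec, hc]; ring
  have eb : resEll (b + secEll c * f) = 0 := by rw [map_add, map_mul, res_sec, h3]; ring
  rw [ea, map_zero, sub_zero] at ha'
  rw [eb, map_zero, sub_zero] at hb'
  refine ⟨a', b', ?_⟩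
  apply mul_left_cancel₀ ell_ne
  linear_combination hab - f * ha' - g * hb'

end MLDeg

namespace MLDeg

/-- maximal ideal of a point -/
noncomputable def mI (p : Fin 3 → ℂ) : Ideal (MvPolynomial (Fin 3) ℂ) := RingHom.ker (eval p)

lemma mem_mI {p : Fin 3 → ℂ} {q : MvPolynomial (Fin 3) ℂ} : q ∈ mI p ↔ eval p q = 0 :=
  RingHom.mem_ker

lemma X_mem_mI (p : Fin 3 → ℂ) (i : Fin 3) : X i - C (p i) ∈ mI p := by simp [mem_mI]

lemma taylor (p : Fin 3 → ℂ) (q : MvPolynomial (Fin 3) ℂ) :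
    q - C (eval p q) - ∑ j, C (eval p (pderiv j q)) * (X j - C (p j)) ∈ (mI p) ^ 2 := by
  induction q using MvPolynomial.induction_on with
  | C a => simp
  | add q r hq hr =>
    convert add_mem hq hr using 1
    simp only [map_add, add_mul, Finset.sum_add_distrib]
    ring
  | mul_X q i hq =>
    have h1 : (X i - C (p i)) * (q - C (eval p q)) ∈ (mI p) ^ 2 := by
      rw [pow_two]
      exact Ideal.mul_mem_mul (X_mem_mI p i) (by simp [mem_mI])
    have h2 := add_mem ((mI p ^ 2).mul_mem_left (C (p i)) hq) h1
    convert h2 using 1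
    simp only [Derivation.leibniz, map_add, smul_eq_mul, map_mul, eval_X, pderiv_X, add_mul,
      Finset.sum_add_distrib]
    have e1 : ∑ j : Fin 3, C (eval p q) * C (eval p (Pi.single (M := fun _ => MvPolynomial (Fin 3) ℂ) j 1 i)) * (X j - C (p j))
        = C (eval p q) * (X i - C (p i)) := by
      rw [Finset.sum_eq_single i]
      · simp
      · intro j _ hj
        simp [Pi.single_eq_of_ne hj.symm]
      · simp
    have e2 : ∑ j : Fin 3, C (p i) * C (eval p (pderiv j q)) * (X j - C (p j))
        = C (p i) * ∑ j : Fin 3, C (eval p (pderiv j q)) * (X j - C (p j)) := by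
      rw [Finset.mul_sum]; simp only [mul_assoc]
    rw [e1, e2]
    ring

lemma mI_coprime {p q : Fin 3 → ℂ} (h : p ≠ q) : IsCoprime (mI p) (mI q) := by
  obtain ⟨i, hi⟩ := Function.ne_iff.1 h
  rw [Ideal.isCoprime_iff_exists]
  have hne : q i - p i ≠ 0 := sub_ne_zero.2 (Ne.symm hi)
  refine ⟨C (q i - p i)⁻¹ * (X i - C (p i)), Ideal.mul_mem_left _ _ (X_mem_mI p i),
    - C (q i - p i)⁻¹ * (X i - C (q i)), Ideal.mul_mem_left _ _ (X_mem_mI q i), ?_⟩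
  have : (C (q i - p i)⁻¹ : MvPolynomial (Fin 3) ℂ) * (C (q i) - C (p i)) = 1 := by
    rw [← C_sub, ← C_mul, inv_mul_cancel₀ hne, C_1]
  linear_combination this

/-- the Jacobian determinant -/
noncomputable def jac (f g : MvPolynomial (Fin 3) ℂ) (v : Fin 3 → ℂ) : ℂ :=
  Matrix.det !![1, 1, 1; eval v (pderiv 0 f), eval v (pderiv 1 f), eval v (pderiv 2 f);
    eval v (pderiv 0 g), eval v (pderiv 1 g), eval v (pderiv 2 g)]

lemma mI_le {f g : MvPolynomial (Fin 3) ℂ} {p : Fin 3 → ℂ} (hf : eval p f = 0)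
    (hg : eval p g = 0) (hl : p 0 + p 1 + p 2 = 1) (hj : jac f g p ≠ 0) :
    mI p ≤ mI p ^ 2 ⊔ Ideal.span {f, g, ell - 1} := by
  set J := mI p ^ 2 ⊔ Ideal.span {f, g, ell - 1} with hJ
  have hsub : ∀ r ∈ ({f, g, ell - 1} : Set (MvPolynomial (Fin 3) ℂ)), eval p r = 0 →
      ∑ j, C (eval p (pderiv j r)) * (X j - C (p j)) ∈ J := by
    intro r hr hr0
    have h1 : r ∈ J := Ideal.mem_sup_right (Ideal.subset_span hr)
    have h2 : _ ∈ J := Ideal.mem_sup_left (taylor p r)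
    rw [hr0, C_0, sub_zero] at h2
    have := J.sub_mem h1 h2
    simpa using this
  have Hf := hsub f (by simp) hf
  have Hg := hsub g (by simp) hg
  have Hl := hsub (ell - 1) (by simp) (by rw [map_sub, eval_ell, hl]; simp)
  have hl' : ∀ j : Fin 3, eval p (pderiv j (ell - 1)) = 1 := by
    intro j; fin_cases j <;> simp [ell, pderiv_X]
  simp only [hl', Fin.sum_univ_three] at Hf Hg Hl
  have hX : ∀ i, X i - C (p i) ∈ J := by
    unfold jac at hj
    set a0 := eval p (pderiv 0 f)
    set a1 := eval p (pderiv 1 f)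
    set a2 := eval p (pderiv 2 f)
    set b0 := eval p (pderiv 0 g)
    set b1 := eval p (pderiv 1 g)
    set b2 := eval p (pderiv 2 g)
    rw [Matrix.det_fin_three] at hj
    simp at hj
    set D := a1 * b2 - a2 * b1 - a0 * b2 + a2 * b0 + a0 * b1 - a1 * b0 with hD
    have hDu : ∀ y, C D * y ∈ J → y ∈ J := by
      intro y hy
      have := J.mul_mem_left (C D⁻¹) hy
      rwa [← mul_assoc, ← C_mul, inv_mul_cancel₀ hj, C_1, one_mul] at this
    have comb : ∀ x y z : ℂ, C x * _ + C y * _ + C z * _ ∈ J := fun x y z =>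
      J.add_mem (J.add_mem (J.mul_mem_left (C x) Hl) (J.mul_mem_left (C y) Hf)) (J.mul_mem_left (C z) Hg)
    intro i
    apply hDu
    fin_cases i
    · convert comb (a1 * b2 - a2 * b1) (b1 - b2) (a2 - a1) using 1
      simp only [hD, map_add, map_sub, map_mul, C_1]
      simp
      ring
    · convert comb (a2 * b0 - a0 * b2) (b2 - b0) (a0 - a2) using 1
      simp only [hD, map_add, map_sub, map_mul, C_1]
      simp
      ring
    · convert comb (a0 * b1 - a1 * b0) (b0 - b1) (a1 - a0) using 1
      simp only [hD, map_add, map_sub, map_mul, C_1]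
      simp
      ring
  intro q hq
  rw [mem_mI] at hq
  have h2 : _ ∈ J := Ideal.mem_sup_left (taylor p q)
  rw [hq, C_0, sub_zero] at h2
  have h3 : ∑ j, C (eval p (pderiv j q)) * (X j - C (p j)) ∈ J :=
    J.sum_mem fun j _ => J.mul_mem_left _ (hX j)
  simpa using J.add_mem h2 h3

lemma prod_le {R ι : Type*} [CommRing R] (K : Ideal R) (m : ι → Ideal R) (T : Finset ι)
    (h : ∀ p ∈ T, m p ≤ m p ^ 2 ⊔ K) : (∏ p ∈ T, m p) ≤ (∏ p ∈ T, m p) ^ 2 ⊔ K := by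
  classical
  induction T using Finset.induction with
  | empty => rw [Finset.prod_empty, one_pow]; exact le_sup_left
  | insert a s ha ih =>
    rw [Finset.prod_insert ha, mul_pow]
    have h1 := h a (by simp)
    have h2 := ih fun p hp => h p (by simp [hp])
    refine (Ideal.mul_mono h1 h2).trans ?_
    rw [Ideal.sup_mul, Ideal.mul_sup]
    refine sup_le (sup_le le_sup_left ?_) ?_
    · exact le_trans (b := K) Ideal.mul_le_right le_sup_right
    · exact le_trans (b := K) Ideal.mul_le_left le_sup_right

lemma iter_le {R : Type*} [CommRing R] (K I : Ideal R) (h : I ≤ I ^ 2 ⊔ K) (n : ℕ) :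
    I ≤ I ^ n ⊔ K := by
  induction n with
  | zero => simp
  | succ n ih =>
    refine h.trans (sup_le ?_ le_sup_right)
    rw [pow_two]
    refine (Ideal.mul_mono_left ih).trans ?_
    rw [Ideal.sup_mul, pow_succ]
    exact sup_le le_sup_left (le_trans (b := K) Ideal.mul_le_left le_sup_right)

lemma mem_of_vanish {f g h : MvPolynomial (Fin 3) ℂ} (Z : Finset (Fin 3 → ℂ))
    (hZ : ∀ v, v ∈ Z ↔ eval v f = 0 ∧ eval v g = 0 ∧ v 0 + v 1 + v 2 = 1)
    (hj : ∀ v ∈ Z, jac f g v ≠ 0) (hh : ∀ v ∈ Z, eval v h = 0) :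
    h ∈ Ideal.span {f, g, ell - 1} := by
  set J := Ideal.span {f, g, ell - 1} with hJ
  have hI : ∏ p ∈ Z, mI p = ⨅ p ∈ Z, mI p :=
    Ideal.prod_eq_iInf_of_pairwise_isCoprime fun p _ q _ hpq => mI_coprime hpq
  have hle : (∏ p ∈ Z, mI p) ≤ J.radical := by
    rw [hI, ← vanishingIdeal_zeroLocus_eq_radical (K := ℂ)]
    intro q hq
    rw [mem_vanishingIdeal_iff]
    intro x hx
    rw [mem_zeroLocus_iff] at hx
    simp only [aeval_eq_eval] at hx ⊢
    have hxZ : x ∈ Z := by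
      rw [hZ]
      refine ⟨hx f (Ideal.subset_span (by simp)), hx g (Ideal.subset_span (by simp)), ?_⟩
      have := hx (ell - 1) (Ideal.subset_span (by simp))
      simp only [map_sub, map_one] at this
      rw [← eval_ell]
      exact sub_eq_zero.1 this
    simp only [Submodule.mem_iInf] at hq
    exact mem_mI.1 (hq x hxZ)
  obtain ⟨n, hn⟩ := Ideal.exists_pow_le_of_le_radical_of_fg hle (IsNoetherian.noetherian _)
  have h1 := prod_le J mI Z (fun p hp => by
    have := (hZ p).1 hp
    exact mI_le this.1 this.2.1 this.2.2 (hj p hp))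
  have h2 := iter_le J _ h1 n
  have h3 : (∏ p ∈ Z, mI p) ≤ J := h2.trans (sup_le hn le_rfl)
  apply h3
  rw [hI]
  simp only [Submodule.mem_iInf]
  exact fun p hp => mem_mI.2 (hh p hp)

lemma hc_span {f g q : MvPolynomial (Fin 3) ℂ} {d e : ℕ} (hf : f.IsHomogeneous d)
    (hg : g.IsHomogeneous e) (hq : q ∈ Ideal.span {f, g}) (n : ℕ) :
    homogeneousComponent n q ∈ Ideal.span {f, g} := by
  let _ := MvPolynomial.gradedAlgebra (σ := Fin 3) (R := ℂ)
  refine homogeneousComponent_mem_of_mem ?_ hq n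
  apply Ideal.homogeneous_span
  rintro x (rfl | rfl)
  · exact ⟨d, hf⟩
  · exact ⟨e, hg⟩

lemma hom_mem {f g h : MvPolynomial (Fin 3) ℂ} {d e N : ℕ} (hf : f.IsHomogeneous d)
    (hg : g.IsHomogeneous e) (hh : h.IsHomogeneous N)
    (hfg : ∀ v : Fin 3 → ℂ, v ≠ 0 → eval v f = 0 → eval v g = 0 → v 0 + v 1 + v 2 ≠ 0)
    (hm : h ∈ Ideal.span {f, g, ell - 1}) : h ∈ Ideal.span {f, g} := by
  set I := Ideal.span {f, g} with hI
  obtain ⟨a, b, c, habc⟩ := Submodule.mem_span_triple.1 hm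
  simp only [smul_eq_mul] at habc
  have h0 : h - c * (ell - 1) ∈ I := by
    rw [Ideal.mem_span_pair]
    exact ⟨a, b, by linear_combination habc⟩
  have hstep : ∀ n, homogeneousComponent (n + 1) h - homogeneousComponent n c * ell
      + homogeneousComponent (n + 1) c ∈ I := by
    intro n
    have := hc_span hf hg h0 (n + 1)
    rw [mul_sub, mul_one, map_sub, map_sub, hc_mul ell_hom] at this
    convert this using 1
    ring
  -- components of c above N
  have hup : ∀ k n, n + k = c.totalDegree + 1 → N ≤ n → homogeneousComponent n c ∈ I := by
    intro k
    induction k with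
    | zero =>
      intro n hn _
      rw [homogeneousComponent_eq_zero _ _ (by omega)]
      exact I.zero_mem
    | succ k ih =>
      intro n hn hN
      have h1 := ih (n + 1) (by omega) (by omega)
      have h2 := hstep n
      rw [homogeneousComponent_of_mem hh, if_neg (by omega)] at h2
      apply ell_cancel hfg
      have := I.sub_mem h1 h2
      convert this using 1
      ring
  have hlow : ∀ n, n < N → homogeneousComponent n c ∈ I := by
    intro n
    induction n with
    | zero =>
      intro hN
      have := hc_span hf hg h0 0
      rw [mul_sub, mul_one, map_sub, map_sub, homogeneousComponent_of_mem hh, if_neg (by omega)] at this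
      have e : homogeneousComponent 0 (c * ell) = 0 := by
        rw [homogeneousComponent_zero]
        simp [ell, ← constantCoeff_eq]
      rw [e] at this
      simpa using this
    | succ n ih =>
      intro hN
      have h2 := hstep n
      rw [homogeneousComponent_of_mem hh, if_neg (by omega)] at h2
      have := I.add_mem h2 (I.mul_mem_right ell (ih (by omega)))
      convert this using 1
      ring
  have hall : ∀ n, homogeneousComponent n c ∈ I := by
    intro n
    by_cases h1 : n < N
    · exact hlow n h1
    · by_cases h2 : n ≤ c.totalDegree + 1
      · exact hup (c.totalDegree + 1 - n) n (by omega) (by omega)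
      · rw [homogeneousComponent_eq_zero _ _ (by omega)]
        exact I.zero_mem
  have hc : c ∈ I := by
    rw [← sum_homogeneousComponent c]
    exact I.sum_mem fun n _ => hall n
  simpa using I.add_mem h0 (I.mul_mem_right (ell - 1) hc)

end MLDeg

namespace MLDeg

/-- the map `(a,b) ↦ a f + b g` on homogeneous pieces -/
noncomputable def psi {f g : MvPolynomial (Fin 3) ℂ} {d e : ℕ} (hf : f.IsHomogeneous d)
    (hg : g.IsHomogeneous e) (k : ℕ) :
    (homogeneousSubmodule (Fin 3) ℂ (k + e) × homogeneousSubmodule (Fin 3) ℂ (k + d)) →ₗ[ℂ]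
      homogeneousSubmodule (Fin 3) ℂ (k + d + e) where
  toFun x := ⟨x.1.1 * f + x.2.1 * g, by
    have h1 := IsHomogeneous.mul x.1.2 hf
    have h2 := IsHomogeneous.mul x.2.2 hg
    rw [show k + e + d = k + d + e by omega] at h1
    exact h1.add h2⟩
  map_add' x y := by
    apply Subtype.ext
    simp only [Prod.fst_add, Prod.snd_add, Submodule.coe_add]
    ring
  map_smul' c x := by
    apply Subtype.ext
    simp [smul_add]

noncomputable def kos {f g : MvPolynomial (Fin 3) ℂ} {d e : ℕ} (hf : f.IsHomogeneous d)
    (hg : g.IsHomogeneous e) (k : ℕ) :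
    homogeneousSubmodule (Fin 3) ℂ k →ₗ[ℂ]
    (homogeneousSubmodule (Fin 3) ℂ (k + e) × homogeneousSubmodule (Fin 3) ℂ (k + d)) where
  toFun x := (⟨x.1 * g, IsHomogeneous.mul x.2 hg⟩, ⟨- (x.1 * f), (IsHomogeneous.mul x.2 hf).neg⟩)
  map_add' x y := by
    apply Prod.ext <;> apply Subtype.ext <;> simp <;> ring
  map_smul' c x := by
    apply Prod.ext <;> apply Subtype.ext <;> simp

lemma relprime_of_jac {f g : MvPolynomial (Fin 3) ℂ}
    (hj : ∀ v : Fin 3 → ℂ, v ≠ 0 → eval v f = 0 → eval v g = 0 → jac f g v ≠ 0) :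
    IsRelPrime f g := by
  rintro p ⟨q, rfl⟩ ⟨r, rfl⟩
  by_contra hp
  obtain ⟨v, hv, h0⟩ := exists_zero (n := 1) p hp
  apply hj v hv (by simp [h0]) (by simp [h0])
  unfold jac
  rw [Matrix.det_fin_three]
  simp [Derivation.leibniz, h0]
  ring

lemma finrank_range_psi {f g : MvPolynomial (Fin 3) ℂ} {d e : ℕ} (hf : f.IsHomogeneous d)
    (hg : g.IsHomogeneous e) (hf0 : f ≠ 0) (hg0 : g ≠ 0) (hrel : IsRelPrime f g) (k : ℕ) :
    Module.finrank ℂ (LinearMap.range (psi hf hg k)) + (k + 2).choose 2 =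
      (k + e + 2).choose 2 + (k + d + 2).choose 2 := by
  have h1 := LinearMap.finrank_range_add_finrank_ker (psi hf hg k)
  rw [Module.finrank_prod, finrank_hom, finrank_hom] at h1
  have hinj : Function.Injective (kos hf hg k) := by
    rw [← LinearMap.ker_eq_bot, LinearMap.ker_eq_bot']
    intro x hx
    have := congrArg (fun y => y.1.1) hx
    simp only [kos, LinearMap.coe_mk, AddHom.coe_mk, Prod.fst_zero, Submodule.coe_zero,
      mul_eq_zero] at this
    exact Subtype.ext (this.resolve_right hg0)
  have hker : LinearMap.ker (psi hf hg k) = LinearMap.range (kos hf hg k) := by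
    ext ⟨a, b⟩
    constructor
    · intro hx
      have hx : a.1 * f + b.1 * g = 0 := congrArg Subtype.val (LinearMap.mem_ker.1 hx)
      have hdv : g ∣ a.1 := hrel.symm.dvd_of_dvd_mul_right ⟨- b.1, by linear_combination hx⟩
      obtain ⟨c, hc⟩ := hdv
      have hb : b.1 = - (c * f) := by
        apply mul_right_cancel₀ hg0
        rw [hc] at hx
        linear_combination hx
      have hcomp : homogeneousComponent k c * g = c * g := by
        rw [← hc_mul hg, mul_comm c g, ← hc]
        exact homogeneousComponent_eq_self a.2
      have hck : homogeneousComponent k c = c := mul_right_cancel₀ hg0 hcomp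
      have hch : c.IsHomogeneous k := hck ▸ homogeneousComponent_isHomogeneous k c
      refine ⟨⟨c, hch⟩, ?_⟩
      apply Prod.ext <;> apply Subtype.ext
      · simp [kos, hc, mul_comm]
      · simp [kos, hb]
    · rintro ⟨c, hc⟩
      rw [← hc, LinearMap.mem_ker]
      apply Subtype.ext
      simp [psi, kos]
      ring
  rw [hker, LinearMap.finrank_range_of_inj hinj, finrank_hom] at h1
  exact h1

/-- evaluation on a finite set of points -/
noncomputable def ev (N : ℕ) (T : Finset (Fin 3 → ℂ)) :
    homogeneousSubmodule (Fin 3) ℂ N →ₗ[ℂ] (T → ℂ) where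
  toFun x := fun t => eval t.1 x.1
  map_add' x y := by ext; simp
  map_smul' c x := by ext; simp [smul_eval]

lemma ev_surj (N : ℕ) (T : Finset (Fin 3 → ℂ)) (hT : ∀ v ∈ T, v 0 + v 1 + v 2 = 1)
    (hN : T.card ≤ N) : Function.Surjective (ev N T) := by
  classical
  have key : ∀ p : T, ∃ x : homogeneousSubmodule (Fin 3) ℂ N, ev N T x = Pi.single p 1 := by
    rintro ⟨p, hp⟩
    have hi : ∀ q : Fin 3 → ℂ, ∃ i, q ≠ p → p i ≠ q i := by
      intro q
      by_cases h : q = p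
      · exact ⟨0, fun h' => absurd h h'⟩
      · obtain ⟨i, hi⟩ := Function.ne_iff.1 h
        exact ⟨i, fun _ => hi.symm⟩
    choose i hi using hi
    set P : MvPolynomial (Fin 3) ℂ := ∏ q ∈ T.erase p, (X (i q) - C (q (i q)) * ell) with hP
    have hPh : P.IsHomogeneous (T.erase p).card := by
      have := IsHomogeneous.prod (T.erase p) (fun q => (X (i q) - C (q (i q)) * ell : MvPolynomial (Fin 3) ℂ))
        (fun _ => 1) (fun q _ => (isHomogeneous_X _ _).sub (ell_hom.C_mul _))
      simpa using this
    have hc : (T.erase p).card ≤ N := (Finset.card_erase_le).trans hN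
    have hell : ∀ v ∈ T, eval v ell = 1 := fun v hv => by rw [eval_ell, hT v hv]
    have hPp : eval p P ≠ 0 := by
      rw [hP, map_prod, Finset.prod_ne_zero_iff]
      intro q hq
      rw [map_sub, map_mul, hell p hp]
      simp only [eval_X, eval_C, mul_one]
      exact sub_ne_zero.2 (hi q (Finset.ne_of_mem_erase hq))
    have hPq : ∀ q ∈ T, q ≠ p → eval q P = 0 := by
      intro q hq hqp
      rw [hP, map_prod]
      apply Finset.prod_eq_zero (Finset.mem_erase.2 ⟨hqp, hq⟩)
      rw [map_sub, map_mul, hell q hq]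
      simp
    refine ⟨⟨C (eval p P)⁻¹ * (P * ell ^ (N - (T.erase p).card)), ?_⟩, ?_⟩
    · have := (hPh.mul (ell_hom.pow (N - (T.erase p).card))).C_mul (eval p P)⁻¹
      rw [show (T.erase p).card + 1 * (N - (T.erase p).card) = N by omega] at this
      exact this
    · ext ⟨q, hq⟩
      simp only [ev, LinearMap.coe_mk, AddHom.coe_mk, map_mul, map_pow, eval_C, hell q hq]
      by_cases h : q = p
      · subst h
        simp [hPp]
      · rw [hPq q hq h, Pi.single_eq_of_ne (by simpa using h)]
        simp
  choose x hx using key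
  intro y
  refine ⟨∑ p, y p • x p, ?_⟩
  rw [map_sum]
  ext q
  simp only [map_smul, hx, Finset.sum_apply, Pi.smul_apply, smul_eq_mul]
  simp [Pi.single_apply]

lemma choose_id (k d e : ℕ) : (k + d + e + 2).choose 2 + (k + 2).choose 2 =
    (k + e + 2).choose 2 + (k + d + 2).choose 2 + d * e := by
  have h : ∀ n : ℕ, ((n + 2).choose 2 : ℚ) = (n + 2) * (n + 1) / 2 := by
    intro n
    rw [Nat.cast_choose_two]
    push_cast; ring
  have : (((k + d + e + 2).choose 2 + (k + 2).choose 2 : ℕ) : ℚ) =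
    (((k + e + 2).choose 2 + (k + d + 2).choose 2 + d * e : ℕ) : ℚ) := by
    push_cast
    rw [h, h, h, h]
    push_cast
    ring
  exact_mod_cast this

/-- Bezout for transversal intersections -/
theorem bezout {f g : MvPolynomial (Fin 3) ℂ} {d e : ℕ} (hf : f.IsHomogeneous d)
    (hg : g.IsHomogeneous e) (hf0 : f ≠ 0) (hg0 : g ≠ 0)
    (hfg : ∀ v : Fin 3 → ℂ, v ≠ 0 → eval v f = 0 → eval v g = 0 → v 0 + v 1 + v 2 ≠ 0)
    (hj : ∀ v : Fin 3 → ℂ, v ≠ 0 → eval v f = 0 → eval v g = 0 → jac f g v ≠ 0) :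
    {v : Fin 3 → ℂ | eval v f = 0 ∧ eval v g = 0 ∧ v 0 + v 1 + v 2 = 1}.ncard = d * e := by
  have hrel := relprime_of_jac hj
  set S := {v : Fin 3 → ℂ | eval v f = 0 ∧ eval v g = 0 ∧ v 0 + v 1 + v 2 = 1} with hS
  -- upper bound
  have main : ∀ T : Finset (Fin 3 → ℂ), (T : Set (Fin 3 → ℂ)) ⊆ S →
      LinearMap.range (psi hf hg T.card) ≤ LinearMap.ker (ev (T.card + d + e) T) ∧
      Module.finrank ℂ (LinearMap.ker (ev (T.card + d + e) T)) + T.card =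
        (T.card + d + e + 2).choose 2 := by
    intro T hT
    constructor
    · rintro _ ⟨⟨a, b⟩, rfl⟩
      rw [LinearMap.mem_ker]
      ext ⟨t, ht⟩
      have := hT ht
      simp [ev, psi, this.1, this.2.1]
    · have h1 := LinearMap.finrank_range_add_finrank_ker (ev (T.card + d + e) T)
      rw [LinearMap.range_eq_top.2 (ev_surj _ T (fun v hv => (hT hv).2.2) (by omega)),
        finrank_top, finrank_hom] at h1
      simp at h1
      omega
  have hub : ∀ T : Finset (Fin 3 → ℂ), (T : Set (Fin 3 → ℂ)) ⊆ S → T.card ≤ d * e := by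
    intro T hT
    obtain ⟨h1, h2⟩ := main T hT
    have h3 := Submodule.finrank_mono h1
    have h4 := finrank_range_psi hf hg hf0 hg0 hrel T.card
    have h5 := choose_id T.card d e
    omega
  have hfin : S.Finite := by
    by_contra hinf
    obtain ⟨T, hT, hc⟩ := Set.Infinite.exists_subset_card_eq hinf (d * e + 1)
    have := hub T hT
    omega
  obtain ⟨Z, hZ⟩ := hfin.exists_finset_coe
  rw [← hZ, Set.ncard_coe_finset]
  have hZm : ∀ v, v ∈ Z ↔ eval v f = 0 ∧ eval v g = 0 ∧ v 0 + v 1 + v 2 = 1 := by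
    intro v
    rw [← Finset.mem_coe, hZ]; rfl
  obtain ⟨h1, h2⟩ := main Z hZ.le
  have h6 : LinearMap.ker (ev (Z.card + d + e) Z) ≤ LinearMap.range (psi hf hg Z.card) := by
    rintro ⟨h, hh⟩ hk
    have hk := LinearMap.mem_ker.1 hk
    have hv : ∀ v ∈ Z, eval v h = 0 := fun v hv => congrFun hk ⟨v, hv⟩
    have hm := mem_of_vanish Z hZm (fun v hv => by
      obtain ⟨x1, x2, x3⟩ := (hZm v).1 hv
      refine hj v ?_ x1 x2
      rintro rfl
      simp at x3) hv
    have hm2 := hom_mem hf hg hh hfg hm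
    obtain ⟨a, b, hab⟩ := Ideal.mem_span_pair.1 hm2
    refine ⟨(⟨homogeneousComponent (Z.card + e) a, homogeneousComponent_isHomogeneous _ _⟩,
      ⟨homogeneousComponent (Z.card + d) b, homogeneousComponent_isHomogeneous _ _⟩), ?_⟩
    apply Subtype.ext
    simp only [psi, LinearMap.coe_mk, AddHom.coe_mk]
    rw [← hc_mul hf, ← hc_mul hg, show Z.card + e + d = Z.card + d + e by omega, ← map_add, hab]
    exact homogeneousComponent_eq_self hh
  have h3 : Module.finrank ℂ (LinearMap.ker (ev (Z.card + d + e) Z)) =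
      Module.finrank ℂ (LinearMap.range (psi hf hg Z.card)) := by
    rw [le_antisymm h6 h1]
  have h4 := finrank_range_psi hf hg hf0 hg0 hrel Z.card
  have h5 := choose_id Z.card d e
  omega

end MLDeg

namespace MLDeg

lemma eval_smul_hom {f : MvPolynomial (Fin 3) ℂ} {d : ℕ} (hf : f.IsHomogeneous d) (c : ℂ)
    (v : Fin 3 → ℂ) : eval (c • v) f = c ^ d * eval v f := by
  rw [eval_eq', eval_eq', Finset.mul_sum]
  apply Finset.sum_congr rfl
  intro m hm
  have : ∑ i, m i = d := by
    rw [← Finsupp.degree_eq_sum]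
    by_contra hne
    exact mem_support_iff.1 hm (hf.coeff_eq_zero hne)
  simp only [Pi.smul_apply, smul_eq_mul, mul_pow, Finset.prod_mul_distrib, Finset.prod_pow_eq_pow_sum,
    this]
  ring

lemma euler {f : MvPolynomial (Fin 3) ℂ} {d : ℕ} (hf : f.IsHomogeneous d) (v : Fin 3 → ℂ)
    (h0 : eval v f = 0) : v 0 * eval v (pderiv 0 f) + v 1 * eval v (pderiv 1 f)
      + v 2 * eval v (pderiv 2 f) = 0 := by
  have := congrArg (eval v) hf.sum_X_mul_pderiv
  simpa [Fin.sum_univ_three, h0] using this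

/-- restriction to a parametrised line -/
noncomputable def linePoly (p c : Fin 3 → ℂ) (f : MvPolynomial (Fin 3) ℂ) : Polynomial ℂ :=
  aeval (fun i => Polynomial.C (p i) + Polynomial.C (c i) * Polynomial.X) f

lemma eval_linePoly (p c : Fin 3 → ℂ) (f : MvPolynomial (Fin 3) ℂ) (t : ℂ) :
    (linePoly p c f).eval t = eval (p + t • c) f := by
  induction f using MvPolynomial.induction_on with
  | C a => simp [linePoly]
  | add q r hq hr => simp only [linePoly, map_add, Polynomial.eval_add] at *; rw [hq, hr]
  | mul_X q i hq =>
    simp only [linePoly, map_mul, Polynomial.eval_mul] at *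
    rw [hq]
    have : c i * t = t * c i := mul_comm _ _
    simp [this]

lemma deriv_linePoly (p c : Fin 3 → ℂ) (f : MvPolynomial (Fin 3) ℂ) (t : ℂ) :
    (linePoly p c f).derivative.eval t = ∑ i, eval (p + t • c) (pderiv i f) * c i := by
  induction f using MvPolynomial.induction_on with
  | C a => simp [linePoly]
  | add q r hq hr =>
    have : linePoly p c (q + r) = linePoly p c q + linePoly p c r := by simp [linePoly]
    rw [this, map_add, Polynomial.eval_add, hq, hr, ← Finset.sum_add_distrib]
    simp [add_mul]
  | mul_X q i hq =>
    have h1 : linePoly p c (q * X i) = linePoly p c q * (Polynomial.C (p i) + Polynomial.C (c i) * Polynomial.X) := by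
      simp [linePoly]
    rw [h1, Polynomial.derivative_mul, Polynomial.eval_add, Polynomial.eval_mul, Polynomial.eval_mul, hq,
      eval_linePoly]
    simp only [Derivation.leibniz, map_add, smul_eq_mul, map_mul, eval_X, pderiv_X, add_mul,
      Finset.sum_add_distrib]
    have e1 : ∑ j : Fin 3, eval (p + t • c) q * eval (p + t • c) (Pi.single (M := fun _ => MvPolynomial (Fin 3) ℂ) j 1 i) * c j
        = eval (p + t • c) q * c i := by
      rw [Finset.sum_eq_single i]
      · simp
      · intro j _ hj
        simp [Pi.single_eq_of_ne hj.symm]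
      · simp
    rw [e1]
    simp only [Polynomial.eval_add, Polynomial.eval_C, Polynomial.eval_mul, Polynomial.eval_X,
      Polynomial.derivative_C, Polynomial.derivative_mul,
      Polynomial.derivative_X, Pi.add_apply, Pi.smul_apply, smul_eq_mul, Finset.sum_mul]
    have : ∑ x, (p i + t * c i) * eval (p + t • c) (pderiv x q) * c x =
      ∑ x, eval (p + t • c) (pderiv x q) * c x * (p i + c i * t) :=
      Finset.sum_congr rfl fun _ _ => by ring
    rw [this]
    simp
    ring

lemma natDegree_linePoly {f : MvPolynomial (Fin 3) ℂ} {d : ℕ} (hf : f.IsHomogeneous d)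
    (p c : Fin 3 → ℂ) : (linePoly p c f).natDegree ≤ d := by
  have := MvPolynomial.aeval_natDegree_le (m := d) (n := 1) f hf.totalDegree_le
    (fun i => Polynomial.C (p i) + Polynomial.C (c i) * Polynomial.X) (fun i => by
      rw [add_comm]; exact Polynomial.natDegree_linear_le)
  simpa [linePoly] using this

lemma linePoly_ne {f : MvPolynomial (Fin 3) ℂ} {d : ℕ} (hf : f.IsHomogeneous d)
    (p c : Fin 3 → ℂ) (hc : eval c f ≠ 0) : linePoly p c f ≠ 0 := by
  intro h0
  have hr : linePoly c p f = 0 := by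
    apply Polynomial.eq_zero_of_infinite_isRoot
    refine Set.Infinite.mono (s := {t : ℂ | t ≠ 0}) ?_ ?_
    · intro t (ht : t ≠ 0)
      have h1 := eval_linePoly p c f t⁻¹
      rw [h0, Polynomial.eval_zero] at h1
      show Polynomial.eval t _ = 0
      rw [eval_linePoly]
      have : c + t • p = t • (p + t⁻¹ • c) := by
        rw [smul_add, smul_smul, mul_inv_cancel₀ ht, one_smul, add_comm]
      rw [this, eval_smul_hom hf, ← h1, mul_zero]
    · exact (Set.finite_singleton (0 : ℂ)).infinite_compl
  have := eval_linePoly c p f 0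
  rw [hr] at this
  simp at this
  exact hc this.symm

lemma exists_basis (L : (Fin 3 → ℂ) →ₗ[ℂ] ℂ) (hL : L ≠ 0) (p : Fin 3 → ℂ) (hp : p ≠ 0)
    (hLp : L p = 0) : ∃ b, L b = 0 ∧ (∀ x y : ℂ, x • p + y • b = 0 → x = 0 ∧ y = 0) ∧
      ∀ w, L w = 0 → ∃ x y : ℂ, w = x • p + y • b := by
  have hfr : Module.finrank ℂ (LinearMap.ker L) = 2 := by
    have h1 := LinearMap.finrank_range_add_finrank_ker L
    rw [LinearMap.range_eq_top.2 (LinearMap.surjective hL)] at h1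
    simp at h1
    omega
  let p' : LinearMap.ker L := ⟨p, hLp⟩
  have hp' : p' ≠ 0 := fun h => hp (congrArg Subtype.val h)
  have hex : ∃ b : LinearMap.ker L, b ∉ Submodule.span ℂ {p'} := by
    by_contra hcon
    push Not at hcon
    have : Submodule.span ℂ {p'} = ⊤ := by rw [eq_top_iff]; exact fun b _ => hcon b
    have h2 := finrank_span_singleton (K := ℂ) hp'
    rw [this, finrank_top, hfr] at h2
    omega
  obtain ⟨b, hb⟩ := hex
  have hli : LinearIndependent ℂ ![p', b] := by
    rw [LinearIndependent.pair_iff' hp']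
    intro a ha
    exact hb (Submodule.mem_span_singleton.2 ⟨a, ha⟩)
  refine ⟨b.1, b.2, ?_, ?_⟩
  · intro x y hxy
    exact LinearIndependent.pair_iff.1 hli x y (Subtype.ext hxy)
  · intro w hw
    have hs := hli.span_eq_top_of_card_eq_finrank (by simp [hfr])
    have : (⟨w, hw⟩ : LinearMap.ker L) ∈ Submodule.span ℂ (Set.range ![p', b]) := by rw [hs]; trivial
    rw [Matrix.range_cons, Matrix.range_cons, Matrix.range_empty, Set.union_empty, Set.singleton_union,
      Submodule.mem_span_pair] at this
    obtain ⟨x, y, hxy⟩ := this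
    exact ⟨x, y, (congrArg Subtype.val hxy).symm⟩

/-- points of the curve on a line -/
def onLine (f : MvPolynomial (Fin 3) ℂ) (L : (Fin 3 → ℂ) →ₗ[ℂ] ℂ) :
    Set (Projectivization ℂ (Fin 3 → ℂ)) := {P | eval P.rep f = 0 ∧ L P.rep = 0}

lemma onLine_aux {f : MvPolynomial (Fin 3) ℂ} {d : ℕ} (hd : 0 < d) (hf : f.IsHomogeneous d)
    (L : (Fin 3 → ℂ) →ₗ[ℂ] ℂ) (hL : L ≠ 0) (hfin : (onLine f L).Finite)
    (p : Fin 3 → ℂ) (hp : p ≠ 0) (hLp : L p = 0) (hfp : eval p f = 0) :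
    (onLine f L).ncard ≤ d ∧
      ((∀ w, L w = 0 → ∑ i, eval p (pderiv i f) * w i = 0) → (onLine f L).ncard < d) := by
  obtain ⟨b, hLb, hind, hspan⟩ := exists_basis L hL p hp hLp
  have hne : ∀ t : ℂ, b + t • p ≠ 0 := by
    intro t ht
    have := (hind t 1 (by rw [one_smul, add_comm]; exact ht)).2
    exact one_ne_zero this
  obtain ⟨t, ht⟩ : ∃ t : ℂ, eval (b + t • p) f ≠ 0 := by
    by_contra hcon
    push Not at hcon
    have hinj : Function.Injective fun t : ℂ => Projectivization.mk ℂ (b + t • p) (hne t) := by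
      intro s t hst
      simp only [Projectivization.mk_eq_mk_iff'] at hst
      obtain ⟨a, ha⟩ := hst
      have h1 := hind (a * t - s) (a - 1) (by
        have : (a * t - s) • p + (a - 1) • b = a • (b + t • p) - (b + s • p) := by
          simp only [smul_add, sub_smul, smul_smul, one_smul]; abel
        rw [this, ha, sub_self])
      have : a = 1 := sub_eq_zero.1 h1.2
      rw [this, one_mul] at h1
      exact (sub_eq_zero.1 h1.1).symm
    have hinf := Set.infinite_range_of_injective hinj
    apply hinf
    refine hfin.subset ?_
    rintro _ ⟨s, rfl⟩
    obtain ⟨a, ha⟩ := Projectivization.exists_smul_eq_mk_rep ℂ (b + s • p) (hne s)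
    have ha' : ((a : ℂ) • (b + s • p)) = (Projectivization.mk ℂ (b + s • p) (hne s)).rep := ha
    show eval _ f = 0 ∧ L _ = 0
    simp only
    rw [← ha', eval_smul_hom hf, hcon, map_smul, map_add, map_smul, hLb, hLp]
    simp
  set c := b + t • p with hc
  have hLc : L c = 0 := by simp [hc, hLb, hLp]
  have hspan' : ∀ w, L w = 0 → ∃ x y : ℂ, w = x • p + y • c := by
    intro w hw
    obtain ⟨x, y, hxy⟩ := hspan w hw
    refine ⟨x - y * t, y, ?_⟩
    rw [hxy, hc, smul_add, sub_smul, smul_smul]; abel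
  set q := linePoly p c f with hq
  have hq0 : q ≠ 0 := linePoly_ne hf p c ht
  have hqd : q.natDegree ≤ d := natDegree_linePoly hf p c
  -- injection to roots
  have hroot : ∀ P ∈ onLine f L, ∃ s : ℂ, s ∈ q.roots.toFinset ∧ ∃ x : ℂ, x ≠ 0 ∧ P.rep = x • (p + s • c) := by
    rintro P ⟨hP1, hP2⟩
    obtain ⟨x, y, hxy⟩ := hspan' _ hP2
    have hx : x ≠ 0 := by
      rintro rfl
      rw [zero_smul, zero_add] at hxy
      rw [hxy, eval_smul_hom hf] at hP1
      rcases mul_eq_zero.1 hP1 with h | h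
      · have : y = 0 := pow_eq_zero_iff (by omega) |>.1 h
        rw [this, zero_smul] at hxy
        exact P.rep_nonzero hxy
      · exact ht h
    have hxy' : P.rep = x • (p + (y / x) • c) := by
      have e : x • ((y / x) • c) = y • c := by rw [smul_smul, mul_div_cancel₀ _ hx]
      rw [smul_add x p, e]; exact hxy
    refine ⟨y / x, ?_, x, hx, hxy'⟩
    rw [Multiset.mem_toFinset, Polynomial.mem_roots hq0, Polynomial.IsRoot, hq, eval_linePoly]
    rw [hxy', eval_smul_hom hf] at hP1
    exact (mul_eq_zero.1 hP1).resolve_left (pow_ne_zero _ hx)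
  choose! s hs hs2 using hroot
  have hcard : (onLine f L).ncard ≤ q.roots.toFinset.card := by
    rw [← Set.ncard_coe_finset]
    refine Set.ncard_le_ncard_of_injOn s (fun P hP => hs P hP) ?_ (Finset.finite_toSet _)
    intro P hP Q hQ hPQ
    obtain ⟨x, hx, hxP⟩ := hs2 P hP
    obtain ⟨y, hy, hyQ⟩ := hs2 Q hQ
    rw [← P.mk_rep, ← Q.mk_rep, Projectivization.mk_eq_mk_iff']
    refine ⟨x / y, ?_⟩
    rw [hxP, hyQ, hPQ, smul_smul, div_mul_cancel₀ _ hy]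
  have hle := Multiset.toFinset_card_le q.roots
  have hle2 := q.card_roots'
  refine ⟨by omega, fun hsing => ?_⟩
  have hd0 : q.derivative.eval 0 = 0 := by
    rw [hq, deriv_linePoly]
    simpa using hsing c hLc
  have h00 : q.eval 0 = 0 := by
    rw [hq, eval_linePoly]; simpa using hfp
  have hmult : 1 < q.rootMultiplicity 0 :=
    (Polynomial.one_lt_rootMultiplicity_iff_isRoot hq0).2 ⟨h00, hd0⟩
  have hlt : q.roots.toFinset.card < Multiset.card q.roots := by
    refine lt_of_le_of_ne hle ?_
    intro heq
    have := Multiset.toFinset_card_eq_card_iff_nodup.1 heq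
    have h2 := Multiset.nodup_iff_count_le_one.1 this 0
    rw [Polynomial.count_roots] at h2
    omega
  omega

end MLDeg

namespace MLDeg

/-- coordinate projections -/
noncomputable abbrev pr (i : Fin 3) : (Fin 3 → ℂ) →ₗ[ℂ] ℂ := LinearMap.proj i

/-- the four lines of the arrangement -/
noncomputable def LL : Fin 4 → ((Fin 3 → ℂ) →ₗ[ℂ] ℂ) :=
  ![pr 0, pr 1, pr 2, pr 0 + pr 1 + pr 2]

lemma LL_ne (k : Fin 4) : LL k ≠ 0 := by
  intro h
  fin_cases k
  · simpa [LL] using LinearMap.congr_fun h ![1, 0, 0]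
  · simpa [LL] using LinearMap.congr_fun h ![0, 1, 0]
  · simpa [LL] using LinearMap.congr_fun h ![0, 0, 1]
  · simpa [LL] using LinearMap.congr_fun h ![0, 0, 1]

lemma LL_prod (v : Fin 3 → ℂ) : v 0 * v 1 * v 2 * (v 0 + v 1 + v 2) = 0 ↔ ∃ k, LL k v = 0 := by
  simp [Fin.exists_fin_succ, LL, or_assoc]

lemma transversal {f : MvPolynomial (Fin 3) ℂ} {d : ℕ} (hd : 0 < d) (hf : f.IsHomogeneous d)
    (ha : ({P : Projectivization ℂ (Fin 3 → ℂ) |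
        eval P.rep f = 0 ∧
        P.rep 0 * P.rep 1 * P.rep 2 *
          (P.rep 0 + P.rep 1 + P.rep 2) = 0}).ncard = 4 * d) (k : Fin 4) (p : Fin 3 → ℂ) (hp : p ≠ 0)
    (hfp : eval p f = 0) (hLp : LL k p = 0) :
    ∃ w, LL k w = 0 ∧ ∑ i, eval p (pderiv i f) * w i ≠ 0 := by
  by_contra hcon
  push Not at hcon
  have hS : {P : Projectivization ℂ (Fin 3 → ℂ) |
        eval P.rep f = 0 ∧
        P.rep 0 * P.rep 1 * P.rep 2 *
          (P.rep 0 + P.rep 1 + P.rep 2) = 0} = ⋃ j ∈ (Finset.univ : Finset (Fin 4)), onLine f (LL j) := by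
    ext P
    simp only [LL_prod, onLine, Set.mem_ofPred_eq, Set.mem_iUnion]
    simp
  have hfinS : (⋃ j ∈ (Finset.univ : Finset (Fin 4)), onLine f (LL j)).Finite := by
    rw [← hS]; exact Set.finite_of_ncard_pos (by omega)
  have hfin : ∀ j, (onLine f (LL j)).Finite := fun j =>
    hfinS.subset (Set.subset_biUnion_of_mem (u := fun j => onLine f (LL j)) (Finset.mem_univ j))
  have hle : ∀ j, (onLine f (LL j)).ncard ≤ d := by
    intro j
    rcases (onLine f (LL j)).eq_empty_or_nonempty with h | ⟨P, hP⟩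
    · rw [h]; simp
    · exact (onLine_aux hd hf (LL j) (LL_ne j) (hfin j) P.rep P.rep_nonzero hP.2 hP.1).1
  have hlt := (onLine_aux hd hf (LL k) (LL_ne k) (hfin k) p hp hLp hfp).2 hcon
  have h1 : (⋃ j ∈ (Finset.univ : Finset (Fin 4)), onLine f (LL j)).ncard ≤ ∑ j, (onLine f (LL j)).ncard :=
    Finset.set_ncard_biUnion_le _ _
  rw [← hS, ha] at h1
  have h2 : ∑ j, (onLine f (LL j)).ncard < ∑ j : Fin 4, d :=
    Finset.sum_lt_sum (fun j _ => hle j) ⟨k, Finset.mem_univ k, hlt⟩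
  simp at h2
  omega

/-- exactly one boundary line -/
def OneLine (v : Fin 3 → ℂ) : Prop :=
  ((v 0 = 0 ∧ v 1 ≠ 0 ∧ v 2 ≠ 0 ∧ v 0 + v 1 + v 2 ≠ 0) ∨
       (v 1 = 0 ∧ v 0 ≠ 0 ∧ v 2 ≠ 0 ∧ v 0 + v 1 + v 2 ≠ 0) ∨
       (v 2 = 0 ∧ v 0 ≠ 0 ∧ v 1 ≠ 0 ∧ v 0 + v 1 + v 2 ≠ 0) ∨
       (v 0 + v 1 + v 2 = 0 ∧ v 0 ≠ 0 ∧ v 1 ≠ 0 ∧ v 2 ≠ 0))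

lemma oneLine_of {f : MvPolynomial (Fin 3) ℂ} {d : ℕ} (hf : f.IsHomogeneous d)
    (h : ∀ P : Projectivization ℂ (Fin 3 → ℂ),
      eval P.rep f = 0 →
      P.rep 0 * P.rep 1 * P.rep 2 * (P.rep 0 + P.rep 1 + P.rep 2) = 0 → OneLine P.rep)
    (v : Fin 3 → ℂ) (hv : v ≠ 0) (hfv : eval v f = 0) (hH : v 0 * v 1 * v 2 * (v 0 + v 1 + v 2) = 0) :
    OneLine v := by
  obtain ⟨a, ha⟩ := Projectivization.exists_smul_eq_mk_rep ℂ v hv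
  have ha' : ((a : ℂ) • v) = (Projectivization.mk ℂ v hv).rep := ha
  have h1 := h (Projectivization.mk ℂ v hv)
  rw [← ha', eval_smul_hom hf, hfv, mul_zero] at h1
  have ha0 : (a : ℂ) ≠ 0 := a.ne_zero
  have e : (a : ℂ) * v 0 + a * v 1 + a * v 2 = a * (v 0 + v 1 + v 2) := by ring
  have h2 := h1 rfl
  simp only [OneLine, Pi.smul_apply, smul_eq_mul, e, mul_eq_zero, ha0, false_or, ne_eq] at h2
  simp only [mul_eq_zero] at hH
  simpa [OneLine] using h2 hH

/-- the cleared critical equation -/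
noncomputable def gU (f : MvPolynomial (Fin 3) ℂ) (u : Fin 3 → ℂ) : MvPolynomial (Fin 3) ℂ :=
  C (u 0) * (X 1 * X 2 * (pderiv 1 f - pderiv 2 f)) + C (u 1) * (X 0 * X 2 * (pderiv 2 f - pderiv 0 f))
    + C (u 2) * (X 0 * X 1 * (pderiv 0 f - pderiv 1 f))

lemma gU_hom {f : MvPolynomial (Fin 3) ℂ} {d : ℕ} (hd : 0 < d) (hf : f.IsHomogeneous d) (u : Fin 3 → ℂ) :
    (gU f u).IsHomogeneous (d + 1) := by
  have h : ∀ i j k l : Fin 3, ∀ c : ℂ,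
      (C c * (X i * X j * (pderiv k f - pderiv l f)) : MvPolynomial (Fin 3) ℂ).IsHomogeneous (d + 1) := by
    intro i j k l c
    have := (isHomogeneous_C (Fin 3) c).mul ((((isHomogeneous_X ℂ i).mul (isHomogeneous_X ℂ j))).mul
      ((hf.pderiv (i := k)).sub (hf.pderiv (i := l))))
    convert this using 1
    omega
  exact ((h _ _ _ _ _).add (h _ _ _ _ _)).add (h _ _ _ _ _)

lemma eval_gU (f : MvPolynomial (Fin 3) ℂ) (u v : Fin 3 → ℂ) : eval v (gU f u) =
    u 0 * (v 1 * v 2 * (eval v (pderiv 1 f) - eval v (pderiv 2 f)))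
    + u 1 * (v 0 * v 2 * (eval v (pderiv 2 f) - eval v (pderiv 0 f)))
    + u 2 * (v 0 * v 1 * (eval v (pderiv 0 f) - eval v (pderiv 1 f))) := by
  simp [gU]

lemma det_gU (f : MvPolynomial (Fin 3) ℂ) (u v : Fin 3 → ℂ) (hv : v 0 * v 1 * v 2 ≠ 0) :
    Matrix.det !![1, 1, 1; u 0 / v 0, u 1 / v 1, u 2 / v 2;
                          eval v (pderiv 0 f), eval v (pderiv 1 f), eval v (pderiv 2 f)] = 0 ↔
    eval v (gU f u) = 0 := by
  have h0 : v 0 ≠ 0 := by rintro h; simp [h] at hv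
  have h1 : v 1 ≠ 0 := by rintro h; simp [h] at hv
  have h2 : v 2 ≠ 0 := by rintro h; simp [h] at hv
  have : eval v (gU f u) = (v 0 * v 1 * v 2) * Matrix.det !![1, 1, 1; u 0 / v 0, u 1 / v 1, u 2 / v 2;
                          eval v (pderiv 0 f), eval v (pderiv 1 f), eval v (pderiv 2 f)] := by
    rw [eval_gU, Matrix.det_fin_three]
    simp
    field_simp
    ring
  rw [this]; simp [hv]

lemma gU_ne {f : MvPolynomial (Fin 3) ℂ} {d : ℕ} (hf : f.IsHomogeneous d)
    (hone : ∀ v : Fin 3 → ℂ, v ≠ 0 → eval v f = 0 → v 0 * v 1 * v 2 * (v 0 + v 1 + v 2) = 0 → OneLine v)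
    (htr : ∀ (k : Fin 4) (p : Fin 3 → ℂ), p ≠ 0 → eval p f = 0 → LL k p = 0 →
      ∃ w, LL k w = 0 ∧ ∑ i, eval p (pderiv i f) * w i ≠ 0)
    (u : Fin 3 → ℂ) (h0 : u 0 ≠ 0) (h1 : u 1 ≠ 0) (h2 : u 2 ≠ 0) (hs : u 0 + u 1 + u 2 ≠ 0)
    (v : Fin 3 → ℂ) (hv : v ≠ 0) (hfv : eval v f = 0) (hH : v 0 * v 1 * v 2 * (v 0 + v 1 + v 2) = 0) :
    eval v (gU f u) ≠ 0 := by
  have he := euler hf v hfv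
  rw [eval_gU]
  intro hg
  rcases hone v hv hfv hH with ⟨z, a, b, c⟩ | ⟨z, a, b, c⟩ | ⟨z, a, b, c⟩ | ⟨z, a, b, c⟩
  · obtain ⟨w, hw, hw2⟩ := htr 0 v hv hfv (by simpa [LL] using z)
    rw [Fin.sum_univ_three] at hw2
    have hw : w 0 = 0 := by simpa [LL] using hw
    rw [z] at hg he c
    have e : eval v (pderiv 1 f) = eval v (pderiv 2 f) := by
      have : u 0 * v 1 * v 2 * (eval v (pderiv 1 f) - eval v (pderiv 2 f)) = 0 := by linear_combination hg
      simpa [h0, a, b, sub_eq_zero] using this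
    have e2 : eval v (pderiv 2 f) = 0 := by
      have : (0 + v 1 + v 2) * eval v (pderiv 2 f) = 0 := by rw [e] at he; linear_combination he
      exact (mul_eq_zero.1 this).resolve_left c
    apply hw2; rw [hw, e, e2]; ring
  · obtain ⟨w, hw, hw2⟩ := htr 1 v hv hfv (by simpa [LL] using z)
    rw [Fin.sum_univ_three] at hw2
    have hw : w 1 = 0 := by simpa [LL] using hw
    rw [z] at hg he c
    have e : eval v (pderiv 2 f) = eval v (pderiv 0 f) := by
      have : u 1 * v 0 * v 2 * (eval v (pderiv 2 f) - eval v (pderiv 0 f)) = 0 := by linear_combination hg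
      simpa [h1, a, b, sub_eq_zero] using this
    have e2 : eval v (pderiv 0 f) = 0 := by
      have : (v 0 + 0 + v 2) * eval v (pderiv 0 f) = 0 := by rw [e] at he; linear_combination he
      exact (mul_eq_zero.1 this).resolve_left c
    apply hw2; rw [hw, e, e2]; ring
  · obtain ⟨w, hw, hw2⟩ := htr 2 v hv hfv (by simpa [LL] using z)
    rw [Fin.sum_univ_three] at hw2
    have hw : w 2 = 0 := by simpa [LL] using hw
    rw [z] at hg he c
    have e : eval v (pderiv 0 f) = eval v (pderiv 1 f) := by
      have : u 2 * v 0 * v 1 * (eval v (pderiv 0 f) - eval v (pderiv 1 f)) = 0 := by linear_combination hg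
      simpa [h2, a, b, sub_eq_zero] using this
    have e2 : eval v (pderiv 1 f) = 0 := by
      have : (v 0 + v 1 + 0) * eval v (pderiv 1 f) = 0 := by rw [e] at he; linear_combination he
      exact (mul_eq_zero.1 this).resolve_left c
    apply hw2; rw [hw, e, e2]; ring
  · obtain ⟨w, hw, hw2⟩ := htr 3 v hv hfv (by simpa [LL] using z)
    rw [Fin.sum_univ_three] at hw2
    have hw : w 0 + w 1 + w 2 = 0 := by simpa [LL] using hw
    generalize eval v (pderiv 0 f) = f0 at *
    generalize eval v (pderiv 1 f) = f1 at *
    generalize eval v (pderiv 2 f) = f2 at *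
    have ez : v 2 = - v 0 - v 1 := by linear_combination z
    -- v0 (f0 - f2) + v1 (f1 - f2) = 0
    have k1 : v 0 * (f2 - f0) = v 1 * (f1 - f2) := by rw [ez] at he; linear_combination -he
    have k2 : v 0 * (f0 - f1) = v 2 * (f1 - f2) := by rw [ez] at he ⊢; linear_combination he
    have k3 : v 1 * v 2 * (f1 - f2) * (u 0 + u 1 + u 2) = 0 := by
      linear_combination hg - u 1 * v 2 * k1 - u 2 * v 1 * k2
    have k4 : f1 = f2 := by simpa [b, c, hs, sub_eq_zero] using k3
    have k5 : f0 = f1 := by rw [← k4] at k2; simpa [a, sub_eq_zero] using k2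
    apply hw2
    rw [k5, ← k4]; linear_combination f1 * hw
end MLDeg

namespace MLDeg
open Filter Topology

lemma hasFDerivAt_eval (h : MvPolynomial (Fin 3) ℂ) (v : Fin 3 → ℂ) :
    HasFDerivAt (fun x : Fin 3 → ℂ => eval x h)
      (∑ i, eval v (pderiv i h) • ContinuousLinearMap.proj (R := ℂ) (φ := fun _ : Fin 3 => ℂ) i) v := by
  induction h using MvPolynomial.induction_on with
  | C a =>
    simp only [eval_C]
    refine (hasFDerivAt_const (𝕜 := ℂ) a v).congr_fderiv ?_
    ext w
    simp
  | add q r hq hr =>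
    have := hq.add hr
    simp only [map_add]
    refine this.congr_fderiv ?_
    rw [← Finset.sum_add_distrib]
    exact Finset.sum_congr rfl fun i _ => (add_smul _ _ _).symm
  | mul_X q i hq =>
    have h1 : HasFDerivAt (fun x : Fin 3 → ℂ => x i)
      (ContinuousLinearMap.proj (R := ℂ) (φ := fun _ : Fin 3 => ℂ) i) v :=
      (ContinuousLinearMap.proj (R := ℂ) (φ := fun _ : Fin 3 => ℂ) i).hasFDerivAt
    have := hq.mul h1
    simp only [map_mul, eval_X]
    refine this.congr_fderiv ?_
    ext w
    fin_cases i <;> simp [Fin.sum_univ_three, Derivation.leibniz, pderiv_X, Pi.single_apply] <;> ring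

lemma hasDerivAt_eval (h : MvPolynomial (Fin 3) ℂ) (γ : ℂ → Fin 3 → ℂ) (γ' : Fin 3 → ℂ) (s : ℂ)
    (hγ : HasDerivAt γ γ' s) :
    HasDerivAt (fun x => eval (γ x) h) (∑ i, eval (γ s) (pderiv i h) * γ' i) s := by
  have := (hasFDerivAt_eval h (γ s)).comp_hasDerivAt s hγ
  refine this.congr_deriv ?_
  simp

/-- tangent direction -/
def tang (F : Fin 3 → ℂ) : Fin 3 → ℂ := ![F 2 - F 1, F 0 - F 2, F 1 - F 0]

/-- gradient -/
noncomputable def grad (f : MvPolynomial (Fin 3) ℂ) (v : Fin 3 → ℂ) : Fin 3 → ℂ :=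
  fun i => eval v (pderiv i f)

lemma tang_cross {F z : Fin 3 → ℂ} (hT : tang F ≠ 0) (hl : z 0 + z 1 + z 2 = 0)
    (hF : ∑ i, F i * z i = 0) : ∃ c : ℂ, z = c • tang F := by
  rw [Fin.sum_univ_three] at hF
  have hz : z 2 = - z 0 - z 1 := by linear_combination hl
  rw [hz] at hF
  obtain ⟨i, hi⟩ := Function.ne_iff.1 hT
  have key : ∀ j, z j * tang F i = z i * tang F j := by
    intro j
    fin_cases i <;> fin_cases j <;> simp [tang, hz] <;> first | linear_combination (0 : ℂ) | linear_combination hF | linear_combination -hF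
  refine ⟨z i / tang F i, ?_⟩
  ext j
  have hi : tang F i ≠ 0 := by simpa using hi
  simp only [Pi.smul_apply, smul_eq_mul]
  field_simp
  exact key j

lemma local_param (f : MvPolynomial (Fin 3) ℂ) (p : Fin 3 → ℂ) (hfp : eval p f = 0)
    (hlp : p 0 + p 1 + p 2 = 1) (hT : tang (grad f p) ≠ 0) :
    ∃ (γ : ℂ → Fin 3 → ℂ) (σ : (Fin 3 → ℂ) → ℂ), AnalyticAt ℂ γ 0 ∧ γ 0 = p ∧
      (∀ᶠ s in 𝓝 (0 : ℂ), eval (γ s) f = 0) ∧ (∀ s, γ s 0 + γ s 1 + γ s 2 = 1) ∧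
      Tendsto σ (𝓝 p) (𝓝 0) ∧
      ∀ᶠ v in 𝓝 p, eval v f = 0 → v 0 + v 1 + v 2 = 1 → v = γ (σ v) := by
  set F := grad f p with hFdef
  set T := tang F with hTdef
  have hFT : ∑ i, F i * T i = 0 := by simp [Fin.sum_univ_three, hTdef, tang]; ring
  have hlT : T 0 + T 1 + T 2 = 0 := by simp [hTdef, tang]
  obtain ⟨w, hlw, hFw⟩ : ∃ w : Fin 3 → ℂ, w 0 + w 1 + w 2 = 0 ∧ ∑ i, F i * w i ≠ 0 := by
    by_contra hcon
    push Not at hcon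
    apply hT
    have a1 := hcon ![0, -1, 1] (by simp)
    have a2 := hcon ![1, 0, -1] (by simp)
    have a3 := hcon ![-1, 1, 0] (by simp)
    simp [Fin.sum_univ_three] at a1 a2 a3
    ext i
    fin_cases i <;> simp [hTdef, tang]
    · linear_combination a1
    · linear_combination a2
    · linear_combination a3
  set κ := ∑ i, F i * w i with hκ
  obtain ⟨j, hj⟩ : ∃ j, T j ≠ 0 := by simpa using Function.ne_iff.1 hT
  let A : ℂ × ℂ → Fin 3 → ℂ := fun x => p + x.1 • T + x.2 • w
  let A' : ℂ × ℂ →L[ℂ] (Fin 3 → ℂ) :=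
    (ContinuousLinearMap.fst ℂ ℂ ℂ).smulRight T + (ContinuousLinearMap.snd ℂ ℂ ℂ).smulRight w
  have hA : ∀ x, HasFDerivAt A A' x := by
    intro x
    have h1 : HasFDerivAt (fun x : ℂ × ℂ => p + A' x) A' x := A'.hasFDerivAt.const_add p
    refine h1.congr_of_eventuallyEq (Eventually.of_forall fun y => ?_)
    simp [A, A', add_assoc]
  let Φ : ℂ × ℂ → ℂ × ℂ := fun x => (x.1, eval (A x) f)
  let e : (ℂ × ℂ) ≃L[ℂ] (ℂ × ℂ) := ContinuousLinearEquiv.prodCongr (ContinuousLinearEquiv.refl ℂ ℂ)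
    (ContinuousLinearEquiv.unitsEquivAut ℂ (Units.mk0 κ hFw))
  have hA0 : A (0, 0) = p := by simp [A]
  have hΦ0 : Φ (0, 0) = (0, 0) := by simp only [Φ, hA0, hfp]
  have hΦ' : HasFDerivAt Φ (e : ℂ × ℂ →L[ℂ] ℂ × ℂ) (0, 0) := by
    have h1 := (hasFDerivAt_eval f (A (0,0))).comp (0, 0) (hA (0,0))
    have h2 := (ContinuousLinearMap.fst ℂ ℂ ℂ).hasFDerivAt (x := ((0, 0) : ℂ × ℂ))
    refine (h2.prodMk h1).congr_fderiv ?_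
    rw [hA0]
    have hFT' : ∑ i, eval p (pderiv i f) * T i = 0 := hFT
    have hκ' : κ = ∑ i, eval p (pderiv i f) * w i := hκ
    ext
    · simp [e, A']
    · simpa [e, A'] using hFT'
    · simp [e, A']
    · simp [e, A', hκ']
  have hΦan : AnalyticAt ℂ Φ (0, 0) := by
    have hAan : ∀ i, AnalyticAt ℂ (fun x => A x i) (0, 0) := by
      intro i
      simp only [A, Pi.add_apply, Pi.smul_apply, smul_eq_mul]
      exact (analyticAt_const.add (analyticAt_fst.mul analyticAt_const)).add
        (analyticAt_snd.mul analyticAt_const)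
    have := AnalyticAt.aeval_mvPolynomial hAan f
    exact analyticAt_fst.prod this
  have hcd : ContDiffAt ℂ ⊤ Φ (0, 0) := hΦan.contDiffAt
  have hstrict := hcd.hasStrictFDerivAt' hΦ' (by simp)
  let Ψ := hstrict.localInverse Φ e (0, 0)
  have hΨan : AnalyticAt ℂ Ψ (0, 0) := by
    have := hcd.to_localInverse hΦ' (by simp)
    rw [hΦ0] at this
    exact this.analyticAt
  have hR := hstrict.eventually_right_inverse
  have hLi := hstrict.eventually_left_inverse
  rw [hΦ0] at hR
  have hΨ0 : Ψ (0, 0) = (0, 0) := by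
    have := hstrict.localInverse_apply_image
    rwa [hΦ0] at this
  let φ : ℂ → ℂ := fun s => (Ψ (s, 0)).2
  have hins : AnalyticAt ℂ (fun s : ℂ => ((s, 0) : ℂ × ℂ)) 0 := analyticAt_id.prod analyticAt_const
  have hφ : AnalyticAt ℂ φ 0 :=
    AnalyticAt.fun_comp (f := fun s : ℂ => Ψ (s, 0)) (g := Prod.snd) analyticAt_snd
      (AnalyticAt.fun_comp (f := fun s : ℂ => ((s, 0) : ℂ × ℂ)) (g := Ψ) hΨan hins)
  let y : (Fin 3 → ℂ) → ℂ := fun v => (∑ i, F i * (v i - p i)) / κ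
  let σ : (Fin 3 → ℂ) → ℂ := fun v => (v j - p j - y v * w j) / T j
  have hy : Continuous y := by fun_prop
  have hσ : Continuous σ := by fun_prop
  have hy0 : y p = 0 := by simp [y]
  have hσ0 : σ p = 0 := by simp [σ, hy0]
  refine ⟨fun s => A (s, φ s), σ, ?_, ?_, ?_, ?_, ?_, ?_⟩
  · simp only [A]
    fun_prop
  · simp [φ, hΨ0, A]
  · have := hins.continuousAt.eventually (p := fun y => Φ (hstrict.localInverse Φ e (0, 0) y) = y) hR
    filter_upwards [this] with s hs
    have hs : Φ (Ψ (s, 0)) = (s, 0) := hs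
    have h1 : (Ψ (s, 0)).1 = s := congrArg Prod.fst hs
    have h2 : eval (A (Ψ (s, 0))) f = 0 := congrArg Prod.snd hs
    have h3 : (s, φ s) = Ψ (s, 0) := Prod.ext h1.symm rfl
    rw [h3, h2]
  · intro s
    simp [A]
    linear_combination hlp + s * hlT + φ s * hlw
  · simpa [hσ0] using hσ.tendsto p
  · have ht : Tendsto (fun v => (σ v, y v)) (𝓝 p) (𝓝 (0, 0)) := by
      have := (hσ.prodMk hy).tendsto p
      simpa [hσ0, hy0] using this
    filter_upwards [ht.eventually hLi] with v hv hfv hlv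
    have hv : Ψ (Φ (σ v, y v)) = (σ v, y v) := hv
    have hAv : A (σ v, y v) = v := by
      obtain ⟨c, hc⟩ := tang_cross (F := F) (z := v - p - y v • w) hT
        (by simp; linear_combination hlv - hlp - y v * hlw)
        (by
          have : ∑ i, F i * (v - p - y v • w) i = (∑ i, F i * (v i - p i)) - y v * κ := by
            rw [hκ, Finset.mul_sum, ← Finset.sum_sub_distrib]
            refine Finset.sum_congr rfl fun i _ => ?_
            simp; ring
          rw [this]
          simp [y, hFw])
      have hcj : σ v = c := by
        have := congrFun hc j
        simp only [Pi.sub_apply, Pi.smul_apply, smul_eq_mul] at this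
        simp only [σ]; rw [this]
        exact mul_div_cancel_right₀ _ hj
      simp only [A]
      rw [hcj, ← hc]
      abel
    have hΦv : Φ (σ v, y v) = (σ v, 0) := by simp only [Φ, hAv, hfv]
    rw [hΦv] at hv
    have : φ (σ v) = y v := congrArg Prod.snd hv
    simp only [this, hAv]

end MLDeg

namespace MLDeg
open Filter Topology

/-- derivative along the tangent direction -/
noncomputable def dT (f h : MvPolynomial (Fin 3) ℂ) (v : Fin 3 → ℂ) : ℂ :=
  ∑ i, eval v (pderiv i h) * tang (grad f v) i

lemma dT_of_tangent {f h : MvPolynomial (Fin 3) ℂ} {v z : Fin 3 → ℂ} {c : ℂ}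
    (hz : z = c • tang (grad f v)) : ∑ i, eval v (pderiv i h) * z i = c * dT f h v := by
  rw [dT, Finset.mul_sum]
  refine Finset.sum_congr rfl fun i _ => ?_
  rw [hz]; simp; ring

/-- critical set of a / b on the affine curve -/
def crit (f a b : MvPolynomial (Fin 3) ℂ) : Set (Fin 3 → ℂ) :=
  {v | eval v f = 0 ∧ v 0 + v 1 + v 2 = 1 ∧ eval v b ≠ 0 ∧
    dT f a v * eval v b - eval v a * dT f b v = 0}

lemma crit_values (f a b : MvPolynomial (Fin 3) ℂ)
    (hT : ∀ v : Fin 3 → ℂ, eval v f = 0 → v 0 + v 1 + v 2 = 1 → tang (grad f v) ≠ 0) :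
    ((fun v => eval v a / eval v b) '' crit f a b).Countable := by
  set τ : (Fin 3 → ℂ) → ℂ := fun v => eval v a / eval v b with hτ
  have hloc : ∀ p ∈ crit f a b, {v | τ v = τ p} ∈ 𝓝[crit f a b] p := by
    intro p hp
    rw [mem_nhdsWithin_iff_eventually]
    obtain ⟨hfp, hlp, hbp, -⟩ := hp
    obtain ⟨γ, σ, hγ, hγ0, hfγ, hlγ, hσ, hv⟩ := local_param f p hfp hlp (hT p hfp hlp)
    have hγi : ∀ i, AnalyticAt ℂ (fun s => γ s i) 0 := by
      intro i
      exact analyticAt_pi_iff.1 hγ i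
    have hpoly : ∀ h : MvPolynomial (Fin 3) ℂ, AnalyticAt ℂ (fun s => eval (γ s) h) 0 := fun h =>
      AnalyticAt.aeval_mvPolynomial hγi h
    have hb0 : eval (γ 0) b ≠ 0 := by rwa [hγ0]
    set r : ℂ → ℂ := fun s => eval (γ s) a / eval (γ s) b with hr
    have hran : AnalyticAt ℂ r 0 := (hpoly a).div (hpoly b) hb0
    have hder : ∀ᶠ s in 𝓝 (0 : ℂ), γ s ∈ crit f a b → deriv r s = 0 := by
      filter_upwards [hγ.eventually_analyticAt, hfγ.eventually_nhds] with s hs hfs hcr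
      obtain ⟨c1, c2, c3, c4⟩ := hcr
      have hd : HasDerivAt γ (deriv γ s) s := hs.differentiableAt.hasDerivAt
      have h1 := hasDerivAt_eval f γ _ s hd
      have h2 : HasDerivAt (fun x => eval (γ x) f) 0 s :=
        (hasDerivAt_const s (0 : ℂ)).congr_of_eventuallyEq hfs
      have h3 := h1.unique h2
      have h4 : deriv γ s 0 + deriv γ s 1 + deriv γ s 2 = 0 := by
        have hdi := hasDerivAt_pi.1 hd
        have h5 := ((hdi 0).add (hdi 1)).add (hdi 2)
        have h6 : HasDerivAt (fun x => γ x 0 + γ x 1 + γ x 2) 0 s := by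
          simp only [hlγ]; exact hasDerivAt_const s (1 : ℂ)
        exact h5.unique h6
      obtain ⟨c, hc⟩ := tang_cross (hT (γ s) c1 c2) h4 h3
      have ha := hasDerivAt_eval a γ _ s hd
      have hb := hasDerivAt_eval b γ _ s hd
      rw [dT_of_tangent hc] at ha hb
      have := (ha.div hb c3).deriv
      have e : deriv r s = _ := this
      rw [e]
      have : c * dT f a (γ s) * (eval (γ s)) b - (eval (γ s)) a * (c * dT f b (γ s)) = 0 := by
        linear_combination c * c4
      rw [this, zero_div]
    rcases hran.deriv.eventually_eq_zero_or_eventually_ne_zero with h0 | h0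
    · have hconst : ∀ᶠ s in 𝓝 (0 : ℂ), r s = r 0 := by
        obtain ⟨ε, hε, hball⟩ := Metric.eventually_nhds_iff_ball.1 (h0.and hran.eventually_analyticAt)
        filter_upwards [Metric.ball_mem_nhds (0 : ℂ) hε] with s hs
        refine (convex_ball (0 : ℂ) ε).is_const_of_fderivWithin_eq_zero (𝕜 := ℂ) (f := r)
          (fun x hx => (hball x hx).2.differentiableAt.differentiableWithinAt) ?_ hs (Metric.mem_ball_self hε)
        intro x hx
        rw [fderivWithin_of_isOpen Metric.isOpen_ball hx]
        ext
        simpa using (hball x hx).1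
      filter_upwards [hv, hσ.eventually hconst] with v hv1 hv2 hvc
      have hv3 := hv1 hvc.1 hvc.2.1
      show τ v = τ p
      have e1 : τ v = r (σ v) := by simp only [hτ, hr]; rw [← hv3]
      have e2 : τ p = r 0 := by simp only [hτ, hr]; rw [hγ0]
      rw [e1, e2, hv2]
    · have h0' : ∀ᶠ s in 𝓝 (0 : ℂ), s ≠ 0 → deriv r s ≠ 0 := eventually_nhdsWithin_iff.1 h0
      filter_upwards [hv, hσ.eventually hder, hσ.eventually h0'] with v hv1 hv2 hv3 hvc
      have hv4 := hv1 hvc.1 hvc.2.1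
      have hs0 : σ v = 0 := by
        by_contra hne
        exact hv3 hne (hv2 (by rwa [← hv4]))
      have : v = p := by rw [hv4, hs0, hγ0]
      rw [this]
  obtain ⟨t, -, htc, hcov⟩ := TopologicalSpace.countable_cover_nhdsWithin hloc
  refine (htc.image τ).mono ?_
  rintro _ ⟨v, hv, rfl⟩
  obtain ⟨x, hx, hxv⟩ := Set.mem_iUnion₂.1 (hcov hv)
  exact ⟨x, hx, hxv.symm⟩

end MLDeg

namespace MLDeg
open Filter Topology

lemma E_countable {f : MvPolynomial (Fin 3) ℂ} {d : ℕ} (hf : f.IsHomogeneous d)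
    (hT : ∀ v : Fin 3 → ℂ, eval v f = 0 → v 0 + v 1 + v 2 = 1 → tang (grad f v) ≠ 0)
    (hc : eval ![1, -1, 0] f ≠ 0) :
    {v : Fin 3 → ℂ | eval v f = 0 ∧ v 0 + v 1 + v 2 = 1 ∧
      eval v (pderiv 0 f) = eval v (pderiv 1 f)}.Countable := by
  have h1 := crit_values f (X 2) 1 hT
  have hfin : ∀ c : ℂ, {v : Fin 3 → ℂ | eval v f = 0 ∧ v 0 + v 1 + v 2 = 1 ∧ v 2 = c}.Finite := by
    intro c
    have hne := linePoly_ne hf ![0, 1 - c, c] ![1, -1, 0] hc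
    refine ((linePoly ![0, 1 - c, c] ![1, -1, 0] f).roots.toFinset.finite_toSet.image
      (fun t : ℂ => (![0, 1 - c, c] + t • ![1, -1, 0] : Fin 3 → ℂ))).subset ?_
    rintro v ⟨hv1, hv2, hv3⟩
    have hv : (![0, 1 - c, c] + v 0 • ![1, -1, 0] : Fin 3 → ℂ) = v := by
      ext i
      fin_cases i
      · simp
      · simp; linear_combination hv3 - hv2
      · simp [hv3]
    refine ⟨v 0, ?_, hv⟩
    rw [Finset.mem_coe, Multiset.mem_toFinset, Polynomial.mem_roots hne, Polynomial.IsRoot, eval_linePoly, hv, hv1]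
  refine (h1.biUnion (t := fun c _ => {v : Fin 3 → ℂ | eval v f = 0 ∧ v 0 + v 1 + v 2 = 1 ∧ v 2 = c})
    fun c _ => (hfin c).countable).mono ?_
  rintro v ⟨hv1, hv2, hv3⟩
  refine Set.mem_iUnion₂.2 ⟨v 2, ⟨v, ⟨hv1, hv2, by simp, ?_⟩, by simp⟩, hv1, hv2, rfl⟩
  simp [dT, Fin.sum_univ_three, tang, grad, pderiv_X, hv3]

lemma jac_eq (f g : MvPolynomial (Fin 3) ℂ) (v : Fin 3 → ℂ) : jac f g v = dT f g v := by
  rw [jac, Matrix.det_fin_three, dT, Fin.sum_univ_three]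
  simp [tang, grad]
  ring

lemma jac_smul {f g : MvPolynomial (Fin 3) ℂ} {d e : ℕ} (hf : f.IsHomogeneous d) (hg : g.IsHomogeneous e)
    (c : ℂ) (v : Fin 3 → ℂ) : jac f g (c • v) = c ^ (d - 1) * c ^ (e - 1) * jac f g v := by
  simp only [jac, Matrix.det_fin_three, eval_smul_hom (hf.pderiv), eval_smul_hom (hg.pderiv)]
  simp
  ring

lemma gU_split (f : MvPolynomial (Fin 3) ℂ) (u : Fin 3 → ℂ) :
    gU f u = gU f ![u 0, u 1, 0] + C (u 2) * gU f ![0, 0, 1] := by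
  simp [gU]

lemma dT_gU (f : MvPolynomial (Fin 3) ℂ) (u v : Fin 3 → ℂ) :
    dT f (gU f u) v = dT f (gU f ![u 0, u 1, 0]) v + u 2 * dT f (gU f ![0, 0, 1]) v := by
  rw [gU_split f u]
  simp only [dT, map_add, Derivation.leibniz, pderiv_C, map_zero, smul_eq_mul, map_mul, eval_C,
    Fin.sum_univ_three]
  ring

lemma tang_ne {f : MvPolynomial (Fin 3) ℂ} {d : ℕ} (hf : f.IsHomogeneous d)
    (hsmooth : ∀ v : Fin 3 → ℂ, v ≠ 0 → eval v f = 0 → ∃ i, eval v (pderiv i f) ≠ 0)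
    (v : Fin 3 → ℂ) (h0 : eval v f = 0) (h1 : v 0 + v 1 + v 2 = 1) : tang (grad f v) ≠ 0 := by
  intro hT
  have a0 := congrFun hT 0
  have a1 := congrFun hT 1
  simp [tang, grad, sub_eq_zero] at a0 a1
  have he := euler hf v h0
  rw [a1, ← a0] at he
  have hz : eval v (pderiv 2 f) = 0 := by linear_combination he - eval v (pderiv 2 f) * h1
  have hv : v ≠ 0 := by rintro rfl; simp at h1
  obtain ⟨i, hi⟩ := hsmooth v hv h0
  fin_cases i
  · exact hi (a1.trans hz)
  · exact hi (a0.symm.trans hz)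
  · exact hi hz

lemma count_of_generic {f : MvPolynomial (Fin 3) ℂ} {d : ℕ} (hd : 0 < d) (hf : f.IsHomogeneous d)
    (hf0 : f ≠ 0)
    (hT : ∀ v : Fin 3 → ℂ, eval v f = 0 → v 0 + v 1 + v 2 = 1 → tang (grad f v) ≠ 0)
    (u : Fin 3 → ℂ)
    (hex : ∃ v : Fin 3 → ℂ, v ≠ 0 ∧ eval v f = 0 ∧ v 0 * v 1 * v 2 * (v 0 + v 1 + v 2) = 0)
    (hb : ∀ v : Fin 3 → ℂ, v ≠ 0 → eval v f = 0 → v 0 * v 1 * v 2 * (v 0 + v 1 + v 2) = 0 →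
      eval v (gU f u) ≠ 0)
    (hg1 : ∀ v ∈ {v : Fin 3 → ℂ | eval v f = 0 ∧ v 0 + v 1 + v 2 = 1 ∧
      eval v (pderiv 0 f) = eval v (pderiv 1 f)}, u 0 ≠ u 1 * v 0 / v 1)
    (hg2 : -u 2 ∉ (fun v => eval v (gU f ![u 0, u 1, 0]) / eval v (gU f ![0, 0, 1])) ''
      crit f (gU f ![u 0, u 1, 0]) (gU f ![0, 0, 1])) :
    {v : Fin 3 → ℂ | eval v f = 0 ∧ v 0 + v 1 + v 2 = 1 ∧
            v 0 * v 1 * v 2 ≠ 0 ∧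
            Matrix.det !![1, 1, 1; u 0 / v 0, u 1 / v 1, u 2 / v 2;
                          eval v (pderiv 0 f), eval v (pderiv 1 f),
                            eval v (pderiv 2 f)] = 0}.ncard = d * (d + 1) := by
  have hghom := gU_hom hd hf u
  have hset : {v : Fin 3 → ℂ | eval v f = 0 ∧ v 0 + v 1 + v 2 = 1 ∧
            v 0 * v 1 * v 2 ≠ 0 ∧
            Matrix.det !![1, 1, 1; u 0 / v 0, u 1 / v 1, u 2 / v 2;
                          eval v (pderiv 0 f), eval v (pderiv 1 f),
                            eval v (pderiv 2 f)] = 0} =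
      {v | eval v f = 0 ∧ eval v (gU f u) = 0 ∧ v 0 + v 1 + v 2 = 1} := by
    ext v
    constructor
    · rintro ⟨h1, h2, h3, h4⟩
      exact ⟨h1, (det_gU f u v h3).1 h4, h2⟩
    · rintro ⟨h1, h2, h3⟩
      have hv : v ≠ 0 := by rintro rfl; simp at h3
      have h4 : v 0 * v 1 * v 2 ≠ 0 := by
        intro h
        exact hb v hv h1 (by rw [h, zero_mul]) h2
      exact ⟨h1, h3, h4, (det_gU f u v h4).2 h2⟩
  rw [hset]
  have hg0 : gU f u ≠ 0 := by
    intro h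
    obtain ⟨v, hv, h1, h2⟩ := hex
    exact hb v hv h1 h2 (by rw [h, map_zero])
  have hfg : ∀ v : Fin 3 → ℂ, v ≠ 0 → eval v f = 0 → eval v (gU f u) = 0 → v 0 + v 1 + v 2 ≠ 0 := by
    intro v hv h1 h2 h3
    exact hb v hv h1 (by rw [h3, mul_zero]) h2
  have hj1 : ∀ v : Fin 3 → ℂ, eval v f = 0 → eval v (gU f u) = 0 → v 0 + v 1 + v 2 = 1 →
      jac f (gU f u) v ≠ 0 := by
    intro v h1 h2 h3 hj
    have hv : v ≠ 0 := by rintro rfl; simp at h3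
    have h4 : v 0 * v 1 * v 2 ≠ 0 := by
      intro h
      exact hb v hv h1 (by rw [h, zero_mul]) h2
    have hv0 : v 0 ≠ 0 := by rintro h; simp [h] at h4
    have hv1 : v 1 ≠ 0 := by rintro h; simp [h] at h4
    have hv2 : v 2 ≠ 0 := by rintro h; simp [h] at h4
    rw [jac_eq, dT_gU] at hj
    have h5 : eval v (gU f ![u 0, u 1, 0]) + u 2 * eval v (gU f ![0, 0, 1]) = 0 := by
      rw [gU_split f u] at h2
      simpa using h2
    by_cases hB : eval v (gU f ![0, 0, 1]) = 0
    · have e1 : eval v (pderiv 0 f) = eval v (pderiv 1 f) := by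
        rw [eval_gU] at hB
        simpa [hv0, hv1, sub_eq_zero] using hB
      apply hg1 v ⟨h1, h3, e1⟩
      rw [eval_gU, e1] at h2
      have h6 : v 2 * (eval v (pderiv 1 f) - eval v (pderiv 2 f)) * (u 0 * v 1 - u 1 * v 0) = 0 := by
        linear_combination h2
      have h7 : eval v (pderiv 1 f) - eval v (pderiv 2 f) ≠ 0 := by
        intro h
        apply hT v h1 h3
        have h : eval v (pderiv 1 f) = eval v (pderiv 2 f) := sub_eq_zero.1 h
        ext i
        fin_cases i <;> simp [tang, grad, e1, h]
      have h8 : u 0 * v 1 - u 1 * v 0 = 0 := by simpa [hv2, h7] using h6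
      field_simp
      linear_combination h8
    · apply hg2
      refine ⟨v, ⟨h1, h3, hB, ?_⟩, ?_⟩
      · linear_combination eval v (gU f ![0, 0, 1]) * hj - dT f (gU f ![0, 0, 1]) v * h5
      · simp only
        rw [div_eq_iff hB]
        linear_combination h5
  refine bezout hf hghom hf0 hg0 hfg ?_
  intro v hv h1 h2 hj
  have hl := hfg v hv h1 h2
  refine hj1 ((v 0 + v 1 + v 2)⁻¹ • v) ?_ ?_ ?_ ?_
  · rw [eval_smul_hom hf, h1, mul_zero]
  · rw [eval_smul_hom hghom, h2, mul_zero]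
  · simp only [Pi.smul_apply, smul_eq_mul]
    field_simp
  · rw [jac_smul hf hghom, hj, mul_zero]

end MLDeg

theorem stmt_5 (d : ℕ) (hd : 0 < d) (f : MvPolynomial (Fin 3) ℂ)
    (hdeg : f.IsHomogeneous d)
    (hsmooth : ∀ v : Fin 3 → ℂ, v ≠ 0 → eval v f = 0 →
      ∃ i, eval v (pderiv i f) ≠ 0)
    (a : ℕ)
    (ha : ({P : Projectivization ℂ (Fin 3 → ℂ) |
        eval P.rep f = 0 ∧
        P.rep 0 * P.rep 1 * P.rep 2 *
          (P.rep 0 + P.rep 1 + P.rep 2) = 0}).ncard = a)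
    (htrans : a = 4 * d ∧ ∀ P : Projectivization ℂ (Fin 3 → ℂ),
      eval P.rep f = 0 →
      P.rep 0 * P.rep 1 * P.rep 2 * (P.rep 0 + P.rep 1 + P.rep 2) = 0 →
      ((P.rep 0 = 0 ∧ P.rep 1 ≠ 0 ∧ P.rep 2 ≠ 0 ∧ P.rep 0 + P.rep 1 + P.rep 2 ≠ 0) ∨
       (P.rep 1 = 0 ∧ P.rep 0 ≠ 0 ∧ P.rep 2 ≠ 0 ∧ P.rep 0 + P.rep 1 + P.rep 2 ≠ 0) ∨
       (P.rep 2 = 0 ∧ P.rep 0 ≠ 0 ∧ P.rep 1 ≠ 0 ∧ P.rep 0 + P.rep 1 + P.rep 2 ≠ 0) ∨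
       (P.rep 0 + P.rep 1 + P.rep 2 = 0 ∧ P.rep 0 ≠ 0 ∧ P.rep 1 ≠ 0 ∧ P.rep 2 ≠ 0))) :
    ∃ U : Set (ℝ × ℝ × ℝ), Dense U ∧
      ∀ u ∈ U, 0 < u.1 → 0 < u.2.1 → 0 < u.2.2 →
        (({v : Fin 3 → ℂ | eval v f = 0 ∧ v 0 + v 1 + v 2 = 1 ∧
            v 0 * v 1 * v 2 ≠ 0 ∧
            Matrix.det !![1, 1, 1;
                          (u.1 : ℂ) / v 0, (u.2.1 : ℂ) / v 1, (u.2.2 : ℂ) / v 2;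
                          eval v (pderiv 0 f), eval v (pderiv 1 f),
                            eval v (pderiv 2 f)] = 0}).ncard : ℤ) =
          (d : ℤ) * (d + 1) := by
  refine ⟨{u : ℝ × ℝ × ℝ | 0 < u.1 → 0 < u.2.1 → 0 < u.2.2 →
        (({v : Fin 3 → ℂ | eval v f = 0 ∧ v 0 + v 1 + v 2 = 1 ∧
            v 0 * v 1 * v 2 ≠ 0 ∧
            Matrix.det !![1, 1, 1;
                          (u.1 : ℂ) / v 0, (u.2.1 : ℂ) / v 1, (u.2.2 : ℂ) / v 2;
                          eval v (pderiv 0 f), eval v (pderiv 1 f),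
                            eval v (pderiv 2 f)] = 0}).ncard : ℤ) =
          (d : ℤ) * (d + 1)}, ?_, fun u hu => hu⟩
  obtain ⟨rfl, htr⟩ := htrans
  have hone := MLDeg.oneLine_of hdeg htr
  have htv := MLDeg.transversal hd hdeg ha
  have hT := MLDeg.tang_ne hdeg hsmooth
  have hc : eval ![1, -1, 0] f ≠ 0 := by
    intro h
    have h0 : (![1, -1, 0] : Fin 3 → ℂ) ≠ 0 := fun h => by simpa using congrFun h 0
    have := hone ![1, -1, 0] h0 h (by simp)
    simp [MLDeg.OneLine] at this
  have hf0 : f ≠ 0 := by rintro rfl; simp at hc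
  have hex : ∃ v : Fin 3 → ℂ, v ≠ 0 ∧ eval v f = 0 ∧ v 0 * v 1 * v 2 * (v 0 + v 1 + v 2) = 0 := by
    obtain ⟨P, hP1, hP2⟩ := Set.nonempty_of_ncard_ne_zero (by rw [ha]; omega)
    exact ⟨P.rep, P.rep_nonzero, hP1, hP2⟩
  have hE := MLDeg.E_countable hdeg hT hc
  have hinj : Function.Injective (fun x : ℝ => (x : ℂ)) := Complex.ofReal_injective
  rw [Metric.dense_iff]
  rintro ⟨x, y, z⟩ r hr
  have hB0 := ((hE.image (fun v => (y : ℂ) * v 0 / v 1)).preimage_of_injOn hinj.injOn).dense_compl ℝ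
  obtain ⟨x', hx'b, hx'⟩ := Metric.dense_iff.1 hB0 x r hr
  have hB2 := (((MLDeg.crit_values f (MLDeg.gU f ![(x' : ℂ), (y : ℂ), 0]) (MLDeg.gU f ![0, 0, 1]) hT).image
    (fun c => -c)).preimage_of_injOn hinj.injOn).dense_compl ℝ
  obtain ⟨z', hz'b, hz'⟩ := Metric.dense_iff.1 hB2 z r hr
  refine ⟨(x', y, z'), ?_, ?_⟩
  · rw [Metric.mem_ball] at *
    simp [Prod.dist_eq, hx'b, hz'b]
  · intro h1 h2 h3
    simp only at h1 h2 h3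
    have h1' : (x' : ℂ) ≠ 0 := by exact_mod_cast h1.ne'
    have h2' : (y : ℂ) ≠ 0 := by exact_mod_cast h2.ne'
    have h3' : (z' : ℂ) ≠ 0 := by exact_mod_cast h3.ne'
    have hs : (x' : ℂ) + y + z' ≠ 0 := by exact_mod_cast (by positivity : x' + y + z' ≠ 0)
    have key := MLDeg.count_of_generic hd hdeg hf0 hT ![(x' : ℂ), y, z'] hex
      (MLDeg.gU_ne hdeg hone htv _ (by simpa using h1') (by simpa using h2') (by simpa using h3')
        (by simpa using hs))
      (fun v hv he => hx' ⟨v, hv, by simpa using he.symm⟩)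
      (fun hm => hz' ⟨_, hm, by simp⟩)
    have key2 := congrArg (Nat.cast (R := ℤ)) key
    push_cast at key2
    exact key2
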